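/- arXiv:1311.3297 — 3 statements merged into one kernel-verified Lean document; each statement's English description precedes it below -/
import Mathlib

section
/- Let α₀ and α₁ be orthonormal vectors in a complex inner product space, let c ∈ [0,1], and let p = c·α₀ + √(1−c²)·α₁. Then the Hermitian operator M = |p⟩⟨p| − c²·|α₀⟩⟨α₀| satisfies ‖M‖ ≤ 1 − (3/4)c⁴, where ‖·‖ denotes the operator norm. -/
theorem aux_real (c s A B : ℝ) (hc0 : 0 ≤ c) (hc1 : c ≤ 1) (hs : 0 ≤ s) (hsc : s ^ 2 = 1 - c ^ 2)
    (hA : 0 ≤ A) (hB : 0 ≤ B) :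
    (c * s * B) ^ 2 + (c * s * A + s ^ 2 * B) ^ 2 ≤ (1 - (3 / 4) * c ^ 4) ^ 2 * (A ^ 2 + B ^ 2) := by
  obtain ⟨x, hx⟩ : ∃ x, x = c ^ 2 := ⟨_, rfl⟩
  obtain ⟨l, hl⟩ : ∃ l, l = 1 - (3 / 4) * x ^ 2 := ⟨_, rfl⟩
  have hx0 : 0 ≤ x := by rw [hx]; positivity
  have hx1 : x ≤ 1 := by rw [hx]; nlinarith
  have hl0 : 0 ≤ l := by nlinarith
  have hc4 : 1 - (3 / 4) * c ^ 4 = l := by rw [hl, hx]; ring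
  have d1 : l ^ 2 - l * (1 - x) - x * (1 - x) = (x / 2 * (1 - 3 / 2 * x)) ^ 2 := by rw [hl]; ring
  have d1' : 0 ≤ l ^ 2 - l * (1 - x) - x * (1 - x) := by rw [d1]; positivity
  have d2 : 0 ≤ l ^ 2 + l * (1 - x) - x * (1 - x) := by
    have := mul_nonneg hl0 (sub_nonneg.2 hx1)
    linarith
  have hlx : 1 ≤ l + x := by nlinarith
  have hQ : 0 ≤ l ^ 2 - (1 - x) := by
    have := mul_nonneg (sub_nonneg.2 hlx) (sub_nonneg.2 hx1)
    nlinarith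
  have hP : 0 ≤ l ^ 2 - x * (1 - x) := by nlinarith
  have hK : x * (1 - x) ^ 3 ≤ (l ^ 2 - x * (1 - x)) * (l ^ 2 - (1 - x)) := by
    have := mul_nonneg d1' d2
    nlinarith
  have hK2 : c * s ^ 3 ≤ √(l ^ 2 - x * (1 - x)) * √(l ^ 2 - (1 - x)) := by
    rw [← Real.sqrt_mul hP]
    apply Real.le_sqrt_of_sq_le
    have : (c * s ^ 3) ^ 2 = x * (1 - x) ^ 3 := by
      rw [hx, ← hsc]; ring
    rw [this]; exact hK
  have e1 := Real.sq_sqrt hP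
  have e2 := Real.sq_sqrt hQ
  generalize √(l ^ 2 - x * (1 - x)) = P at *
  generalize √(l ^ 2 - (1 - x)) = Q at *
  have h3 := mul_le_mul_of_nonneg_right hK2 (mul_nonneg hA hB)
  have h4 := sq_nonneg (P * A - Q * B)
  have hsx : s ^ 2 = 1 - x := by rw [hx, hsc]
  have e : (c * s * B) ^ 2 + (c * s * A + s ^ 2 * B) ^ 2
      = x * (1 - x) * A ^ 2 + (1 - x) * B ^ 2 + 2 * (c * s ^ 3 * (A * B)) := by
    have : (c * s * B) ^ 2 + (c * s * A + s ^ 2 * B) ^ 2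
      = c ^ 2 * s ^ 2 * A ^ 2 + (c ^ 2 * s ^ 2 + s ^ 2 * s ^ 2) * B ^ 2
        + 2 * (c * s ^ 3 * (A * B)) := by ring
    rw [this, hsx, ← hx]; ring
  rw [hc4, e]
  have h5 : P ^ 2 * A ^ 2 = (l ^ 2 - x * (1 - x)) * A ^ 2 := by rw [e1]
  have h6 : Q ^ 2 * B ^ 2 = (l ^ 2 - (1 - x)) * B ^ 2 := by rw [e2]
  nlinarith

theorem aux_pyth {E : Type*} [NormedAddCommGroup E] [InnerProductSpace ℂ E]
    (α₀ α₁ : E) (h0 : ‖α₀‖ = 1) (h1 : ‖α₁‖ = 1)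
    (horth : inner (𝕜 := ℂ) α₀ α₁ = 0) (z w : ℂ) :
    ‖z • α₀ + w • α₁‖ ^ 2 = ‖z‖ ^ 2 + ‖w‖ ^ 2 := by
  have := norm_add_sq_eq_norm_sq_add_norm_sq_of_inner_eq_zero (𝕜 := ℂ) (z • α₀) (w • α₁)
    (by simp [inner_smul_left, inner_smul_right, horth])
  rw [norm_smul, norm_smul, h0, h1] at this
  nlinarith

theorem aux_bessel {E : Type*} [NormedAddCommGroup E] [InnerProductSpace ℂ E]
    (α₀ α₁ : E) (h0 : ‖α₀‖ = 1) (h1 : ‖α₁‖ = 1)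
    (horth : inner (𝕜 := ℂ) α₀ α₁ = 0) (u : E) :
    ‖inner ℂ α₀ u‖ ^ 2 + ‖inner ℂ α₁ u‖ ^ 2 ≤ ‖u‖ ^ 2 := by
  have ho : Orthonormal ℂ ![α₀, α₁] := by
    have h' : inner (𝕜 := ℂ) α₁ α₀ = 0 := inner_eq_zero_symm.1 horth
    refine ⟨fun i => by fin_cases i <;> simp [h0, h1], fun i j hij => ?_⟩
    fin_cases i <;> fin_cases j <;> simp_all
  have := ho.sum_inner_products_le u (s := Finset.univ)
  simpa [Fin.sum_univ_two] using this

/-- Let `α₀` and `α₁` be orthonormal vectors in a complex inner product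
space, let `c ∈ [0,1]`, and let `p = c·α₀ + √(1−c²)·α₁`.  Then the Hermitian operator
`M = |p⟩⟨p| − c²·|α₀⟩⟨α₀|` satisfies `‖M‖ ≤ 1 − (3/4)c⁴`, where `‖·‖` is the operator norm
and `|v⟩⟨v|` denotes the rank-one operator `u ↦ ⟨v,u⟩·v`. -/
theorem rank_one_perturbation_norm
    {E : Type*} [NormedAddCommGroup E] [InnerProductSpace ℂ E]
    (α₀ α₁ : E) (h0 : ‖α₀‖ = 1) (h1 : ‖α₁‖ = 1)
    (horth : inner (𝕜 := ℂ) α₀ α₁ = 0)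
    (c : ℝ) (hc0 : 0 ≤ c) (hc1 : c ≤ 1)
    (p : E) (hp : p = (c : ℂ) • α₀ + ((Real.sqrt (1 - c ^ 2) : ℝ) : ℂ) • α₁)
    (M : E →L[ℂ] E)
    (hM : M = (innerSL ℂ p).smulRight p - ((c : ℂ) ^ 2) • (innerSL ℂ α₀).smulRight α₀) :
    ‖M‖ ≤ 1 - (3 / 4) * c ^ 4 := by
  have hc2 : 0 ≤ 1 - c ^ 2 := by nlinarith
  have hs := Real.sqrt_nonneg (1 - c ^ 2)
  have hsc := Real.sq_sqrt hc2
  generalize √(1 - c ^ 2) = s at *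
  have hl : 0 ≤ 1 - (3 / 4) * c ^ 4 := by
    have : c ^ 4 ≤ 1 := pow_le_one₀ hc0 hc1
    linarith
  refine ContinuousLinearMap.opNorm_le_bound _ hl fun u => ?_
  have hMu : M u = ((c : ℂ) * s * inner ℂ α₁ u) • α₀
      + ((c : ℂ) * s * inner ℂ α₀ u + (s : ℂ) ^ 2 * inner ℂ α₁ u) • α₁ := by
    rw [hM, hp]
    simp only [ContinuousLinearMap.sub_apply, ContinuousLinearMap.smul_apply,
      ContinuousLinearMap.smulRight_apply, innerSL_apply_apply, inner_add_left, inner_smul_left,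
      Complex.conj_ofReal]
    module
  refine (sq_le_sq₀ (norm_nonneg _) (mul_nonneg hl (norm_nonneg _))).1 ?_
  rw [hMu, aux_pyth α₀ α₁ h0 h1 horth, mul_pow]
  have hb := aux_bessel α₀ α₁ h0 h1 horth u
  have hr := aux_real c s ‖inner ℂ α₀ u‖ ‖inner ℂ α₁ u‖ hc0 hc1 hs hsc (norm_nonneg _) (norm_nonneg _)
  have n1 : ‖(c : ℂ) * s * inner ℂ α₁ u‖ = c * s * ‖inner ℂ α₁ u‖ := by
    simp [abs_of_nonneg hc0, abs_of_nonneg hs]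
  have n2 : ‖(c : ℂ) * s * inner ℂ α₀ u + (s : ℂ) ^ 2 * inner ℂ α₁ u‖
      ≤ c * s * ‖inner ℂ α₀ u‖ + s ^ 2 * ‖inner ℂ α₁ u‖ := by
    refine (norm_add_le _ _).trans (le_of_eq ?_)
    simp [abs_of_nonneg hc0, abs_of_nonneg hs]
  rw [n1]
  calc _ ≤ (c * s * ‖inner ℂ α₁ u‖) ^ 2
        + (c * s * ‖inner ℂ α₀ u‖ + s ^ 2 * ‖inner ℂ α₁ u‖) ^ 2 := by gcongr
    _ ≤ _ := hr
    _ ≤ _ := by gcongr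
end

section
/- Let d ≥ 1 and M ≥ 1 be integers and let W₁,…,W_{2M} be unitary operators on ℂ^d satisfying W_{2M}W_{2M−1}⋯W₁ = 1. On ℂ^d ⊗ ℂ^{2M} (clock basis |1⟩,…,|2M⟩ with the convention |2M+1⟩ = |1⟩), define H = −√2 Σ_{t=1}^{2M} ( W_t† ⊗ |t⟩⟨t+1| + W_t ⊗ |t+1⟩⟨t| ). Then the operator V = Σ_{t=1}^{2M} (W_{t−1}W_{t−2}⋯W₁) ⊗ |t⟩⟨t| (with the empty product equal to the identity) is unitary and satisfies V† H V = −√2 · 1 ⊗ Σ_{t=1}^{2M}( |t⟩⟨t+1| + |t+1⟩⟨t| ). Consequently, the multiset of eigenvalues of H is { −2√2·cos(πℓ/M) : ℓ = 0,1,…,2M−1 }, each value in this list occurring with multiplicity d. -/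
open scoped Matrix

/-- The cyclic successor on `Fin n` (realizing the periodic clock convention
`|2M+1⟩ = |1⟩`). -/
def cycSucc {n : ℕ} (s : Fin n) : Fin n :=
  ⟨((s : ℕ) + 1) % n, Nat.mod_lt _ s.pos⟩

/-- The Feynman–Kitaev Hamiltonian
`H = −√2 Σ_{t=1}^{2M} ( W_t† ⊗ |t⟩⟨t+1| + W_t ⊗ |t+1⟩⟨t| )` on `ℂ^d ⊗ ℂ^{2M}` with
periodic clock convention `|2M+1⟩ = |1⟩`.  Here the clock label `t ∈ {1,…,2M}` is
represented by the index `t − 1 : Fin (2M)` and `W` is 0-indexed accordingly. -/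
noncomputable def clockHam (d M : ℕ) (W : ℕ → Matrix (Fin d) (Fin d) ℂ) :
    Matrix (Fin d × Fin (2 * M)) (Fin d × Fin (2 * M)) ℂ :=
  Matrix.of fun p q =>
    (-(Real.sqrt 2) : ℂ) * ∑ s : Fin (2 * M),
      ((W (s : ℕ))ᴴ p.1 q.1 * (if p.2 = s ∧ q.2 = cycSucc s then (1 : ℂ) else 0)
        + (W (s : ℕ)) p.1 q.1 * (if p.2 = cycSucc s ∧ q.2 = s then (1 : ℂ) else 0))

/-- `W_t W_{t−1} ⋯ W_1` in 1-indexed notation: the ordered product of the first `t`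
unitaries (0-indexed: `W_{t−1} ⋯ W_0`), the empty product being `1`. -/
noncomputable def partialProd (d : ℕ) (W : ℕ → Matrix (Fin d) (Fin d) ℂ) (t : ℕ) :
    Matrix (Fin d) (Fin d) ℂ :=
  ((List.range t).reverse.map W).prod

/-- `V = Σ_{t=1}^{2M} (W_{t−1}W_{t−2}⋯W₁) ⊗ |t⟩⟨t|`. -/
noncomputable def clockV (d M : ℕ) (W : ℕ → Matrix (Fin d) (Fin d) ℂ) :
    Matrix (Fin d × Fin (2 * M)) (Fin d × Fin (2 * M)) ℂ :=
  Matrix.of fun p q =>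
    if p.2 = q.2 then partialProd d W (q.2 : ℕ) p.1 q.1 else 0

lemma fk_pp_succ (d : ℕ) (W : ℕ → Matrix (Fin d) (Fin d) ℂ) (t : ℕ) :
    partialProd d W (t + 1) = W t * partialProd d W t := by
  simp [partialProd, List.range_succ]

lemma fk_pp_unitary (d : ℕ) (W : ℕ → Matrix (Fin d) (Fin d) ℂ)
    (hW : ∀ t, W t ∈ Matrix.unitaryGroup (Fin d) ℂ) (t : ℕ) :
    (partialProd d W t)ᴴ * partialProd d W t = 1 := by
  induction t with
  | zero => simp [partialProd]
  | succ k ih =>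
    have h1 : (W k)ᴴ * W k = 1 := (Matrix.mem_unitaryGroup_iff').1 (hW k)
    rw [fk_pp_succ, Matrix.conjTranspose_mul, Matrix.mul_assoc, ← Matrix.mul_assoc (W k)ᴴ, h1,
      Matrix.one_mul, ih]

lemma fk_pp_cyc (d n : ℕ) (W : ℕ → Matrix (Fin d) (Fin d) ℂ)
    (hprod : partialProd d W n = 1) (a : Fin n) :
    partialProd d W (cycSucc a : Fin n) = W a * partialProd d W a := by
  rw [← fk_pp_succ]
  have := a.2
  rcases Nat.lt_or_ge ((a : ℕ) + 1) n with h | h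
  · simp [cycSucc, Nat.mod_eq_of_lt h]
  · have h2 : (a : ℕ) + 1 = n := by omega
    simp only [cycSucc, h2, Nat.mod_self, hprod]
    simp [partialProd]

lemma fk_cyc_inj (n : ℕ) : Function.Injective (cycSucc : Fin n → Fin n) := by
  intro a b h
  have h1 : ((a : ℕ) + 1) % n = ((b : ℕ) + 1) % n := congrArg Fin.val h
  have h2 : (a : ℕ) ≡ b [MOD n] := Nat.ModEq.add_right_cancel' 1 h1
  exact Fin.ext (Nat.ModEq.eq_of_lt_of_lt h2 a.2 b.2)

noncomputable def fkT (d M : ℕ) : Matrix (Fin d × Fin (2 * M)) (Fin d × Fin (2 * M)) ℂ :=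
  Matrix.of fun p q : Fin d × Fin (2 * M) =>
            if p.1 = q.1 then
              (-(Real.sqrt 2) : ℂ) *
                ((if q.2 = cycSucc p.2 then (1 : ℂ) else 0)
                  + (if p.2 = cycSucc q.2 then (1 : ℂ) else 0))
            else (0 : ℂ)

lemma fk_V_unitary (d M : ℕ) (W : ℕ → Matrix (Fin d) (Fin d) ℂ)
    (hW : ∀ t, W t ∈ Matrix.unitaryGroup (Fin d) ℂ) :
    (clockV d M W)ᴴ * clockV d M W = 1 := by
  ext ⟨i, a⟩ ⟨j, b⟩
  have h := congrFun (congrFun (fk_pp_unitary d W hW b) i) j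
  rw [Matrix.mul_apply] at h ⊢
  simp only [Matrix.conjTranspose_apply] at h
  rw [Fintype.sum_prod_type_right]
  simp only [clockV, Matrix.conjTranspose_apply, Matrix.of_apply, Matrix.one_apply, Prod.mk.injEq]
  rw [Finset.sum_eq_single b]
  · by_cases hab : b = a
    · subst hab
      simpa [Matrix.one_apply] using h
    · simp [hab, Ne.symm hab]
  · intro c _ hc
    simp [hc]
  · simp

lemma fk_HV (d M : ℕ) (W : ℕ → Matrix (Fin d) (Fin d) ℂ)
    (hW : ∀ t, W t ∈ Matrix.unitaryGroup (Fin d) ℂ)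
    (hprod : partialProd d W (2 * M) = 1) :
    clockHam d M W * clockV d M W = clockV d M W * fkT d M := by
  ext ⟨i, a⟩ ⟨j, b⟩
  have hR : (clockV d M W * fkT d M) (i, a) (j, b) = partialProd d W a i j *
      ((-(Real.sqrt 2) : ℂ) * ((if b = cycSucc a then (1 : ℂ) else 0)
                  + (if a = cycSucc b then (1 : ℂ) else 0))) := by
    rw [Matrix.mul_apply, Fintype.sum_prod_type_right, Finset.sum_eq_single a,
      Finset.sum_eq_single j]
    · simp [clockV, fkT]
    · intro k _ hk
      simp [fkT, hk]
    · simp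
    · intro c _ hc
      simp [clockV, Ne.symm hc]
    · simp
  have hH : ∀ k, clockHam d M W (i, a) (k, b) = (-(Real.sqrt 2) : ℂ) *
      ((W a)ᴴ i k * (if b = cycSucc a then (1 : ℂ) else 0)
        + W b i k * (if a = cycSucc b then (1 : ℂ) else 0)) := by
    intro k
    simp only [clockHam, Matrix.of_apply]
    rw [Finset.sum_add_distrib]
    congr 2
    · rw [Finset.sum_eq_single a]
      · simp
      · intro s _ hs
        simp [Ne.symm hs]
      · simp
    · rw [Finset.sum_eq_single b]
      · simp
      · intro s _ hs
        simp [Ne.symm hs]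
      · simp
  have hL : (clockHam d M W * clockV d M W) (i, a) (j, b) = (-(Real.sqrt 2) : ℂ) *
      (((W a)ᴴ * partialProd d W b) i j * (if b = cycSucc a then (1 : ℂ) else 0)
        + (W b * partialProd d W b) i j * (if a = cycSucc b then (1 : ℂ) else 0)) := by
    rw [Matrix.mul_apply, Fintype.sum_prod_type_right, Finset.sum_eq_single b]
    · simp only [hH, Matrix.mul_apply, Finset.sum_mul, ← Finset.sum_add_distrib, Finset.mul_sum]
      refine Finset.sum_congr rfl fun k _ => ?_
      simp only [clockV, Matrix.of_apply, if_true]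
      ring
    · intro c _ hc
      simp [clockV, hc]
    · simp
  rw [hL, hR]
  have h1 : b = cycSucc a → (W a)ᴴ * partialProd d W b = partialProd d W a := by
    intro h
    have h1 : (W a)ᴴ * W a = 1 := (Matrix.mem_unitaryGroup_iff').1 (hW a)
    rw [h, fk_pp_cyc d _ W hprod, ← Matrix.mul_assoc, h1, Matrix.one_mul]
  have h2 : a = cycSucc b → W b * partialProd d W b = partialProd d W a := by
    intro h
    rw [h, fk_pp_cyc d _ W hprod]
  have e1 : ((W a)ᴴ * partialProd d W b) i j * (if b = cycSucc a then (1 : ℂ) else 0)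
      = partialProd d W a i j * (if b = cycSucc a then (1 : ℂ) else 0) := by
    split_ifs with h
    · rw [h1 h]
    · simp
  have e2 : (W b * partialProd d W b) i j * (if a = cycSucc b then (1 : ℂ) else 0)
      = partialProd d W a i j * (if a = cycSucc b then (1 : ℂ) else 0) := by
    split_ifs with h
    · rw [h2 h]
    · simp
  rw [e1, e2]
  ring

noncomputable def fkOm (M : ℕ) : ℂ := Complex.exp (2 * Real.pi * Complex.I / ((2 * M : ℕ) : ℂ))

noncomputable def fkF (d M : ℕ) : Matrix (Fin d × Fin (2 * M)) (Fin d × Fin (2 * M)) ℂ :=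
  Matrix.kroneckerMap (· * ·) (1 : Matrix (Fin d) (Fin d) ℂ)
    (Matrix.vandermonde fun l : Fin (2 * M) => fkOm M ^ (l : ℕ))ᵀ

noncomputable def fkEv (M l : ℕ) : ℂ := ((-2 * Real.sqrt 2 * Real.cos (Real.pi * l / M) : ℝ) : ℂ)

lemma fk_prim (M : ℕ) (hM : 1 ≤ M) : IsPrimitiveRoot (fkOm M) (2 * M) :=
  Complex.isPrimitiveRoot_exp _ (by omega)

lemma fk_F_det (d M : ℕ) (hM : 1 ≤ M) : (fkF d M).det ≠ 0 := by
  rw [fkF, Matrix.det_kronecker, Matrix.det_transpose]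
  simp only [Matrix.det_one, one_pow, one_mul]
  apply pow_ne_zero
  rw [Matrix.det_vandermonde_ne_zero_iff]
  intro a b h
  exact Fin.ext ((fk_prim M hM).pow_inj a.2 b.2 h)

lemma fk_ev (M l : ℕ) (hM : 1 ≤ M) :
    fkEv M l = -(Real.sqrt 2 : ℂ) * (fkOm M ^ l + (fkOm M ^ l)⁻¹) := by
  have hM' : (M : ℂ) ≠ 0 := by exact_mod_cast (by omega : M ≠ 0)
  have h : fkOm M ^ l = Complex.exp ((Real.pi * l / M : ℂ) * Complex.I) := by
    rw [fkOm, ← Complex.exp_nat_mul]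
    congr 1
    push_cast
    field_simp
  rw [h, ← Complex.exp_neg, fkEv]
  push_cast
  rw [Complex.cos]
  ring_nf

lemma fk_TF (d M : ℕ) (hM : 1 ≤ M) :
    fkT d M * fkF d M = fkF d M * Matrix.diagonal fun p => fkEv M (p.2 : ℕ) := by
  ext ⟨i, a⟩ ⟨j, l⟩
  rw [Matrix.mul_diagonal, Matrix.mul_apply, Fintype.sum_prod_type, Finset.sum_eq_single i]
  rotate_left
  · intro k _ hk
    simp [fkT, Ne.symm hk]
  · simp
  obtain ⟨c, rfl⟩ := (Finite.injective_iff_surjective.1 (fk_cyc_inj (2 * M))) a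
  have hw0 : fkOm M ^ (l : ℕ) ≠ 0 := pow_ne_zero _ (Complex.exp_ne_zero _)
  have hw1 : (fkOm M ^ (l : ℕ)) ^ (2 * M) = 1 := by
    rw [← pow_mul, mul_comm, pow_mul, (fk_prim M hM).pow_eq_one, one_pow]
  have hs : ∀ a : Fin (2 * M), (fkOm M ^ (l : ℕ)) ^ ((cycSucc a : Fin (2 * M)) : ℕ)
      = fkOm M ^ (l : ℕ) * (fkOm M ^ (l : ℕ)) ^ (a : ℕ) := by
    intro a
    rw [← pow_succ']
    exact (pow_eq_pow_mod _ hw1).symm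
  rw [fk_ev M l hM]
  simp only [fkT, fkF, Matrix.of_apply, if_true, Matrix.kroneckerMap_apply, Matrix.transpose_apply,
    Matrix.vandermonde_apply, (fk_cyc_inj (2 * M)).eq_iff]
  simp only [mul_add, add_mul, Finset.sum_add_distrib, mul_ite, ite_mul, mul_one, mul_zero,
    zero_mul, Finset.sum_ite_eq, Finset.sum_ite_eq', Finset.mem_univ, if_true]
  rw [hs, hs]
  field_simp

/-- Let `d ≥ 1` and `M ≥ 1` be integers and let `W₁,…,W_{2M}` be
unitary operators on `ℂ^d` satisfying `W_{2M}W_{2M−1}⋯W₁ = 1`.  Then the operator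
`V = Σ_{t=1}^{2M} (W_{t−1}⋯W₁) ⊗ |t⟩⟨t|` is unitary and satisfies
`V† H V = −√2 · 1 ⊗ Σ_{t=1}^{2M}( |t⟩⟨t+1| + |t+1⟩⟨t| )`, where `H` is the Hamiltonian
`clockHam`.  Consequently, the multiset of eigenvalues of `H` is
`{ −2√2·cos(πℓ/M) : ℓ = 0,1,…,2M−1 }`, each value in this list occurring with
multiplicity `d`. -/
theorem feynman_kitaev_clock_spectrum
    (d M : ℕ) (hd : 1 ≤ d) (hM : 1 ≤ M)
    (W : ℕ → Matrix (Fin d) (Fin d) ℂ)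
    (hW : ∀ t, W t ∈ Matrix.unitaryGroup (Fin d) ℂ)
    (hprod : partialProd d W (2 * M) = 1) :
    clockV d M W ∈ Matrix.unitaryGroup (Fin d × Fin (2 * M)) ℂ
    ∧ (clockV d M W)ᴴ * clockHam d M W * clockV d M W
        = (Matrix.of fun p q : Fin d × Fin (2 * M) =>
            if p.1 = q.1 then
              (-(Real.sqrt 2) : ℂ) *
                ((if q.2 = cycSucc p.2 then (1 : ℂ) else 0)
                  + (if p.2 = cycSucc q.2 then (1 : ℂ) else 0))
            else (0 : ℂ))
    ∧ (Matrix.charpoly (clockHam d M W)).roots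
        = (Multiset.range (2 * M)).bind fun ℓ =>
            Multiset.replicate d
              (((-2 * Real.sqrt 2 * Real.cos (Real.pi * ℓ / M) : ℝ)) : ℂ) := by
  have hV := fk_V_unitary d M W hW
  have hHV := fk_HV d M W hW hprod
  refine ⟨(Matrix.mem_unitaryGroup_iff').2 hV, ?_, ?_⟩
  · rw [Matrix.mul_assoc, hHV, ← Matrix.mul_assoc, hV, Matrix.one_mul]
    rfl
  · have hdet : IsUnit (clockV d M W * fkF d M) := by
      rw [Matrix.isUnit_iff_isUnit_det, Matrix.det_mul]
      refine IsUnit.mul ?_ (isUnit_iff_ne_zero.2 (fk_F_det d M hM))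
      rw [← Matrix.isUnit_iff_isUnit_det]
      exact IsUnit.of_mul_eq_one_right _ hV
    obtain ⟨A, hA⟩ := hdet
    have hHA : clockHam d M W * A.val = A.val * Matrix.diagonal fun p => fkEv M (p.2 : ℕ) := by
      rw [hA, ← Matrix.mul_assoc, hHV, Matrix.mul_assoc, fk_TF d M hM, Matrix.mul_assoc]
    have hH : clockHam d M W
        = A.val * (Matrix.diagonal fun p => fkEv M (p.2 : ℕ)) * (A⁻¹).val := by
      rw [← hHA, Matrix.mul_assoc, Units.mul_inv, Matrix.mul_one]
    rw [hH, Matrix.coe_units_inv, Matrix.charpoly_units_conj, Matrix.charpoly_diagonal, Fintype.prod_prod_type_right]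
    simp only [Finset.prod_const, Finset.card_univ, Fintype.card_fin]
    rw [Fin.prod_univ_eq_prod_range (fun l => (Polynomial.X - Polynomial.C (fkEv M l)) ^ d) (2 * M),
      Polynomial.roots_prod]
    · simp only [Polynomial.roots_pow, Polynomial.roots_X_sub_C, Multiset.nsmul_singleton]
      rfl
    · rw [Finset.prod_ne_zero_iff]
      intro l _
      exact pow_ne_zero _ (Polynomial.X_sub_C_ne_zero _)
end

section
/- The smallest eigenvalue of H_prop + H_penalty equals e₁ = −1 − 3√2, and every eigenvalue of H_prop + H_penalty other than e₁ is at least e₁ + 1/(5M²). -/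
open scoped Matrix

namespace QC

/-- `ω = e^{iπ/4}`. -/
noncomputable def omega : ℂ := Complex.exp (Real.pi * Complex.I / 4)

/-- The cyclic shift on `ℂ⁸`: `S|j⟩ = |j+1 mod 8⟩`. -/
noncomputable def S8 : Matrix (Fin 8) (Fin 8) ℂ :=
  Matrix.of fun i j => if i = j + 1 then 1 else 0

/-- `|ω⟩ = (1/√8) Σ_{j=0}^{7} ω^{−j} |j⟩`. -/
noncomputable def omegaVec : Fin 8 → ℂ :=
  fun j => ((1 : ℝ) / Real.sqrt 8 : ℝ) * omega ^ (-(j : ℤ))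

/-- `|ω*⟩ = (1/√8) Σ_{j=0}^{7} ω^{j} |j⟩`. -/
noncomputable def omegaStarVec : Fin 8 → ℂ :=
  fun j => ((1 : ℝ) / Real.sqrt 8 : ℝ) * omega ^ (j : ℕ)

/-- The Hadamard gate `H = (1/√2)[[1,1],[1,−1]]`. -/
noncomputable def Hmat : Matrix (Fin 2) (Fin 2) ℂ :=
  ((1 : ℝ) / Real.sqrt 2 : ℝ) • (!![1, 1; 1, -1] : Matrix (Fin 2) (Fin 2) ℂ)

/-- The gate `T = diag(1, ω)`. -/
noncomputable def Tmat : Matrix (Fin 2) (Fin 2) ℂ := !![1, 0; 0, omega]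

/-- For a matrix `W` all of whose entries are `0` or integer powers of `ω`, the operator
`B(W)` obtained by replacing each entry `ω^k` by `S^k` (and each zero entry by the zero
block): since `(S^k)_{ij} = [i−j ≡ k (mod 8)]` and the powers `ω^0,…,ω^7` are distinct,
this is implemented by `B(W)_{(a,i),(b,j)} = [W a b = ω^{(i−j) mod 8}]`. -/
noncomputable def Bmat {κ : Type*} (W : Matrix κ κ ℂ) :
    Matrix (κ × Fin 8) (κ × Fin 8) ℂ :=
  Matrix.of fun p q => if W p.1 q.1 = omega ^ ((p.2 - q.2 : Fin 8) : ℕ) then 1 else 0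

/-- Computational basis configurations of `n` qubits. -/
abbrev QState (n : ℕ) := Fin n → Fin 2

/-- A single-qubit gate `g` applied to qubit `q` of `n` qubits (tensored with the
identity on the remaining qubits). -/
noncomputable def applySingle (n : ℕ) (g : Matrix (Fin 2) (Fin 2) ℂ) (q : Fin n) :
    Matrix (QState n) (QState n) ℂ :=
  Matrix.of fun x y =>
    (if ∀ u, u ≠ q → x u = y u then (1 : ℂ) else 0) * g (x q) (y q)

/-- A two-qubit gate `g` applied to the ordered pair of qubits `(q, r)` of `n` qubits. -/
noncomputable def applyTwo (n : ℕ) (g : Matrix (Fin 2 × Fin 2) (Fin 2 × Fin 2) ℂ)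
    (q r : Fin n) : Matrix (QState n) (QState n) ℂ :=
  Matrix.of fun x y =>
    (if ∀ u, u ≠ q → u ≠ r → x u = y u then (1 : ℂ) else 0) * g (x q, x r) (y q, y r)

/-- The controlled-NOT gate (first qubit control): `|a,b⟩ ↦ |a, b⊕a⟩`. -/
noncomputable def CNOTmat : Matrix (Fin 2 × Fin 2) (Fin 2 × Fin 2) ℂ :=
  Matrix.of fun p q => if p.1 = q.1 ∧ p.2 = q.2 + q.1 then 1 else 0

/-- The two-qubit gate `(H⊗1)·CNOT`. -/
noncomputable def HCNOT : Matrix (Fin 2 × Fin 2) (Fin 2 × Fin 2) ℂ :=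
  (Matrix.of fun p q : Fin 2 × Fin 2 =>
    Hmat p.1 q.1 * (if p.2 = q.2 then (1 : ℂ) else 0)) * CNOTmat

/-- A gate of the circuit: one of `H`, `HT`, `(HT)†` applied to a single qubit, or
`(H⊗1)·CNOT` applied to an ordered pair of distinct qubits. -/
def AllowedGate (n : ℕ) (Ug : Matrix (QState n) (QState n) ℂ) : Prop :=
  (∃ q : Fin n, Ug = applySingle n Hmat q ∨ Ug = applySingle n (Hmat * Tmat) q
      ∨ Ug = applySingle n ((Hmat * Tmat)ᴴ) q)
  ∨ (∃ q r : Fin n, q ≠ r ∧ Ug = applyTwo n HCNOT q r)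

/-- `W_t = U_t` for `1 ≤ t ≤ M` and `W_t = U_{2M+1−t}†` for `M+1 ≤ t ≤ 2M`
(0-indexed: `W_s = U_s` for `s < M` and `W_s = (U_{2M−1−s})†` otherwise). -/
noncomputable def Wseq (n M : ℕ) (U : ℕ → Matrix (QState n) (QState n) ℂ) (t : ℕ) :
    Matrix (QState n) (QState n) ℂ :=
  if t < M then U t else (U (2 * M - 1 - t))ᴴ

/-- The cyclic successor on `Fin m` (realizing the periodic clock convention
`|2M+1⟩ = |1⟩`). -/
def cycSucc {m : ℕ} (s : Fin m) : Fin m :=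
  ⟨((s : ℕ) + 1) % m, Nat.mod_lt _ s.pos⟩

/-- The vertex set used in the circuit-to-graph construction:
`(ℂ²)^{⊗n} ⊗ ℂ^{2M} ⊗ ℂ⁸` (clock labels `1,…,2M` represented by `Fin (2M)` with label
`t ↔ index t−1`). -/
abbrev CVertex (n M : ℕ) := QState n × Fin (2 * M) × Fin 8

/-- `H_prop = Σ_{t=1}^{2M}( (B(W_t)†)_{13}⊗(|t⟩⟨t+1|)_2 + (B(W_t))_{13}⊗(|t+1⟩⟨t|)_2 )`,
where `B(W_t)` is obtained from `−√2·W_t` by the substitution `ω^k ↦ S^k`. -/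
noncomputable def HpropC (n M : ℕ) (U : ℕ → Matrix (QState n) (QState n) ℂ) :
    Matrix (CVertex n M) (CVertex n M) ℂ :=
  Matrix.of fun p q => ∑ s : Fin (2 * M),
    ((if p.2.1 = s ∧ q.2.1 = cycSucc s then
        (Bmat ((-(Real.sqrt 2) : ℂ) • Wseq n M U (s : ℕ)))ᴴ (p.1, p.2.2) (q.1, q.2.2)
      else 0)
      + (if p.2.1 = cycSucc s ∧ q.2.1 = s then
        Bmat ((-(Real.sqrt 2) : ℂ) • Wseq n M U (s : ℕ)) (p.1, p.2.2) (q.1, q.2.2)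
      else 0))

/-- `H_penalty = 1 ⊗ 1 ⊗ (S³ + S⁴ + S⁵)`. -/
noncomputable def HpenC (n M : ℕ) : Matrix (CVertex n M) (CVertex n M) ℂ :=
  Matrix.of fun p q =>
    if p.1 = q.1 ∧ p.2.1 = q.2.1 then (S8 ^ 3 + S8 ^ 4 + S8 ^ 5) p.2.2 q.2.2 else 0

/-- `H_input = Σ_{j=n_in+1}^{n} (|1⟩⟨1|)_j ⊗ |1⟩⟨1| ⊗ 1` (the middle projector onto the
clock state `|1⟩`, which is the clock index `0`). -/
noncomputable def HinC (n M nin : ℕ) : Matrix (CVertex n M) (CVertex n M) ℂ :=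
  Matrix.of fun p q =>
    if p = q ∧ (p.2.1 : ℕ) = 0 then
      ((Finset.univ.filter fun j : Fin n => nin ≤ (j : ℕ) ∧ p.1 j = 1).card : ℂ)
    else 0

/-- `H_output = (|0⟩⟨0|)_out ⊗ |M+1⟩⟨M+1| ⊗ 1` (clock label `M+1` is clock index `M`). -/
noncomputable def HoutC (n M : ℕ) (out : Fin n) :
    Matrix (CVertex n M) (CVertex n M) ℂ :=
  Matrix.of fun p q =>
    if p = q ∧ p.1 out = 0 ∧ (p.2.1 : ℕ) = M then 1 else 0

/-- The symmetric 0-1 matrix `A_x = H_prop + H_penalty + H_input + H_output`. -/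
noncomputable def Ax (n M nin : ℕ) (out : Fin n)
    (U : ℕ → Matrix (QState n) (QState n) ℂ) :
    Matrix (CVertex n M) (CVertex n M) ℂ :=
  HpropC n M U + HpenC n M + HinC n M nin + HoutC n M out

/-- `e₁ = −1 − 3√2`. -/
noncomputable def e1 : ℝ := -1 - 3 * Real.sqrt 2

/-- `U_C = U_M ⋯ U_1` (0-indexed: `U_{M−1} ⋯ U_0`). -/
noncomputable def circuitU (n M : ℕ) (U : ℕ → Matrix (QState n) (QState n) ℂ) :
    Matrix (QState n) (QState n) ℂ :=
  ((List.range M).reverse.map U).prod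

/-- The input state `ψ ⊗ |0⟩^{⊗(n−n_in)}` for `ψ ∈ (ℂ²)^{⊗n_in}`. -/
noncomputable def embedInput (n nin : ℕ) (h : nin ≤ n) (ψ : QState nin → ℂ) :
    QState n → ℂ :=
  fun x => (if ∀ j : Fin n, nin ≤ (j : ℕ) → x j = 0 then (1 : ℂ) else 0)
    * ψ (fun i : Fin nin => x (Fin.castLE h i))

/-- The acceptance probability
`AP(ψ) = ‖ (|1⟩⟨1|)_out · U_C (ψ ⊗ |0⟩^{⊗(n−n_in)}) ‖²`. -/
noncomputable def acceptProb (n M nin : ℕ) (h : nin ≤ n) (out : Fin n)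
    (U : ℕ → Matrix (QState n) (QState n) ℂ) (ψ : QState nin → ℂ) : ℝ :=
  ∑ x : QState n,
    if x out = 1 then
      Complex.normSq ((circuitU n M U).mulVec (embedInput n nin h ψ) x)
    else 0

end QC

open QC

namespace QC

theorem omega_prim : IsPrimitiveRoot omega 8 := by
  have h := Complex.isPrimitiveRoot_exp 8 (by norm_num)
  have e : omega = Complex.exp (2 * Real.pi * Complex.I / ((8 : ℕ) : ℂ)) := by
    unfold omega; congr 1; push_cast; ring
  rw [e]; exact h

theorem omega_eq : omega = ((Real.sqrt 2 / 2 : ℝ) : ℂ) * (1 + Complex.I) := by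
  unfold omega
  have e : (Real.pi * Complex.I / 4 : ℂ) = ((Real.pi / 4 : ℝ) : ℂ) * Complex.I := by
    push_cast; ring
  rw [e, Complex.exp_mul_I, ← Complex.ofReal_cos, ← Complex.ofReal_sin, Real.cos_pi_div_four,
    Real.sin_pi_div_four]
  ring

theorem omega_pow8 : omega ^ 8 = 1 := omega_prim.pow_eq_one

theorem sqrt2_sq : ((Real.sqrt 2 : ℝ) : ℂ) ^ 2 = 2 := by
  rw [← Complex.ofReal_pow, Real.sq_sqrt (by norm_num)]; norm_num

theorem omega_sq : omega ^ 2 = Complex.I := by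
  rw [omega_eq, mul_pow]
  push_cast
  rw [div_pow, sqrt2_sq]
  linear_combination (1 / 2 : ℂ) * Complex.I_sq

theorem omega_pow4 : omega ^ 4 = -1 := by
  rw [show (4 : ℕ) = 2 * 2 by norm_num, pow_mul, omega_sq, Complex.I_sq]

theorem conj_mul_self {z : ℂ} (hz : z ^ 8 = 1) : star z * z = 1 := by
  have h : ‖z‖ = 1 := Complex.norm_eq_one_of_pow_eq_one hz (by norm_num)
  have := Complex.conj_mul' z
  rw [h] at this
  simpa using this

theorem fin_pow_add {z : ℂ} (hz : z ^ 8 = 1) (a b : Fin 8) :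
    z ^ ((a + b : Fin 8) : ℕ) = z ^ (a : ℕ) * z ^ (b : ℕ) := by
  rw [← pow_add, Fin.val_add]
  conv_rhs => rw [← Nat.mod_add_div ((a : ℕ) + b) 8, pow_add, pow_mul, hz, one_pow, mul_one]

theorem fin_pow_sub {z : ℂ} (hz : z ^ 8 = 1) (a b : Fin 8) :
    z ^ ((a - b : Fin 8) : ℕ) = z ^ (a : ℕ) * star (z ^ (b : ℕ)) := by
  have h := fin_pow_add hz (a - b) b
  rw [sub_add_cancel] at h
  have h2 : star (z ^ (b : ℕ)) * z ^ (b : ℕ) = 1 :=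
    conj_mul_self (by rw [← pow_mul, mul_comm, pow_mul, hz, one_pow])
  rw [h, mul_assoc, mul_comm (z ^ (b : ℕ)), h2, mul_one]

theorem omega_inj {a b : Fin 8} (h : omega ^ (a : ℕ) = omega ^ (b : ℕ)) : a = b :=
  Fin.ext (omega_prim.pow_inj a.2 b.2 h)

/-- Image of an entry under the substitution `ω ↦ z`. -/
noncomputable def Cz (z w : ℂ) : ℂ := ∑ m : Fin 8, if w = omega ^ (m : ℕ) then z ^ (m : ℕ) else 0

/-- Entries are zero or powers of omega. -/
def Good (w : ℂ) : Prop := w = 0 ∨ ∃ m : Fin 8, w = omega ^ (m : ℕ)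

theorem Cz_pow (z : ℂ) (m : Fin 8) : Cz z (omega ^ (m : ℕ)) = z ^ (m : ℕ) := by
  unfold Cz
  rw [Finset.sum_eq_single m]
  · simp
  · intro b _ hb
    rw [if_neg]
    intro h; exact hb (omega_inj h).symm
  · simp

theorem omega_ne : omega ≠ 0 := omega_prim.ne_zero (by norm_num)

theorem Cz_zero (z : ℂ) : Cz z 0 = 0 := by
  unfold Cz
  apply Finset.sum_eq_zero
  intro m _
  rw [if_neg]
  exact (pow_ne_zero _ omega_ne).symm

theorem Cz_omega {w : ℂ} (h : Good w) : Cz omega w = w := by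
  rcases h with rfl | ⟨m, rfl⟩
  · exact Cz_zero _
  · exact Cz_pow _ _

theorem Cz_conj (z w : ℂ) : Cz (star z) w = star (Cz z w) := by
  unfold Cz
  rw [star_sum]
  refine Finset.sum_congr rfl fun m _ => ?_
  split_ifs <;> simp

theorem Cz_norm {z w : ℂ} (hz : z ^ 8 = 1) (h : Good w) : ‖Cz z w‖ = ‖w‖ ^ 2 := by
  have h1 : ‖z‖ = 1 := Complex.norm_eq_one_of_pow_eq_one hz (by norm_num)
  have h2 : ‖omega‖ = 1 := Complex.norm_eq_one_of_pow_eq_one omega_pow8 (by norm_num)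
  rcases h with rfl | ⟨m, rfl⟩
  · simp [Cz_zero]
  · rw [Cz_pow]; simp [h1, h2]

theorem Good_star {w : ℂ} (h : Good w) : Good (star w) := by
  rcases h with rfl | ⟨m, rfl⟩
  · left; simp
  · right; refine ⟨-m, ?_⟩
    have := fin_pow_sub omega_pow8 0 m
    simp only [zero_sub] at this
    rw [this]; simp

section trans
variable {κ : Type*} [Fintype κ]

theorem trans_B {z : ℂ} (hz : z ^ 8 = 1) (W : Matrix κ κ ℂ) (f : κ → Fin 8 → ℂ) (x : κ) :
    ∑ i : Fin 8, z ^ (i : ℕ) * (∑ y, ∑ j, Bmat W (x, i) (y, j) * f y j)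
      = ∑ y, Cz z (W x y) * ∑ j : Fin 8, z ^ (j : ℕ) * f y j := by
  simp only [Finset.mul_sum]
  rw [Finset.sum_comm]
  refine Finset.sum_congr rfl fun y _ => ?_
  rw [Finset.sum_comm]
  refine Finset.sum_congr rfl fun j _ => ?_
  rw [← Equiv.sum_comp (Equiv.addRight j)]
  unfold Cz
  rw [Finset.sum_mul]
  refine Finset.sum_congr rfl fun m _ => ?_
  simp only [Equiv.coe_addRight, Bmat, Matrix.of_apply, add_sub_cancel_right]
  rw [fin_pow_add hz]
  split_ifs <;> ring

theorem trans_BH {z : ℂ} (hz : z ^ 8 = 1) (W : Matrix κ κ ℂ) (f : κ → Fin 8 → ℂ) (x : κ) :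
    ∑ i : Fin 8, z ^ (i : ℕ) * (∑ y, ∑ j, (Bmat W)ᴴ (x, i) (y, j) * f y j)
      = ∑ y, star (Cz z (W y x)) * ∑ j : Fin 8, z ^ (j : ℕ) * f y j := by
  simp only [Finset.mul_sum]
  rw [Finset.sum_comm]
  refine Finset.sum_congr rfl fun y _ => ?_
  rw [Finset.sum_comm]
  refine Finset.sum_congr rfl fun j _ => ?_
  rw [← (Equiv.subLeft j).sum_comp]
  unfold Cz
  rw [star_sum, Finset.sum_mul]
  refine Finset.sum_congr rfl fun m _ => ?_
  simp only [Equiv.subLeft_apply, Matrix.conjTranspose_apply, Bmat, Matrix.of_apply, sub_sub_cancel]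
  rw [fin_pow_sub hz]
  split_ifs
  · simp only [star_one]; ring
  · simp

theorem ev_B (W : Matrix κ κ ℂ) (hW : ∀ x y, Good (W x y)) (φ : κ → ℂ) (x : κ) (i : Fin 8) :
    ∑ y, ∑ j : Fin 8, Bmat W (x, i) (y, j) * (star (omega ^ (j : ℕ)) * φ y)
      = star (omega ^ (i : ℕ)) * ∑ y, W x y * φ y := by
  rw [Finset.mul_sum]
  refine Finset.sum_congr rfl fun y _ => ?_
  rw [← (Equiv.subLeft i).sum_comp]
  conv_rhs => rw [← Cz_omega (hW x y)]
  unfold Cz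
  rw [Finset.sum_mul, Finset.mul_sum]
  refine Finset.sum_congr rfl fun m _ => ?_
  simp only [Equiv.subLeft_apply, Bmat, Matrix.of_apply, sub_sub_cancel]
  rw [fin_pow_sub omega_pow8]
  split_ifs
  · simp only [star_mul', star_star]; ring
  · simp

theorem ev_BH (W : Matrix κ κ ℂ) (hW : ∀ x y, Good (W x y)) (φ : κ → ℂ) (x : κ) (i : Fin 8) :
    ∑ y, ∑ j : Fin 8, (Bmat W)ᴴ (x, i) (y, j) * (star (omega ^ (j : ℕ)) * φ y)
      = star (omega ^ (i : ℕ)) * ∑ y, star (W y x) * φ y := by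
  rw [Finset.mul_sum]
  refine Finset.sum_congr rfl fun y _ => ?_
  rw [← Equiv.sum_comp (Equiv.addRight i)]
  conv_rhs => rw [← Cz_omega (hW y x)]
  unfold Cz
  rw [star_sum, Finset.sum_mul, Finset.mul_sum]
  refine Finset.sum_congr rfl fun m _ => ?_
  simp only [Equiv.coe_addRight, Matrix.conjTranspose_apply, Bmat, Matrix.of_apply,
    add_sub_cancel_right]
  rw [fin_pow_add omega_pow8]
  split_ifs
  · simp only [star_mul', star_one]; ring
  · simp

end trans

theorem pen_trans {z : ℂ} (hz : z ^ 8 = 1) (f : Fin 8 → ℂ) :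
    ∑ i : Fin 8, z ^ (i : ℕ) * (∑ j, (S8 ^ 3 + S8 ^ 4 + S8 ^ 5) i j * f j)
      = (z ^ 3 + z ^ 4 + z ^ 5) * ∑ j : Fin 8, z ^ (j : ℕ) * f j := by
  have h1 : Matrix.vecMul (fun i : Fin 8 => z ^ (i : ℕ)) S8 = z • (fun i : Fin 8 => z ^ (i : ℕ)) := by
    ext j
    simp only [Matrix.vecMul, dotProduct, S8, Matrix.of_apply, mul_ite, mul_one, mul_zero,
      Finset.sum_ite_eq', Finset.mem_univ, if_true, Pi.smul_apply, smul_eq_mul]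
    rw [fin_pow_add hz]; simp; ring
  have hk : ∀ k : ℕ, Matrix.vecMul (fun i : Fin 8 => z ^ (i : ℕ)) (S8 ^ k)
      = z ^ k • (fun i : Fin 8 => z ^ (i : ℕ)) := by
    intro k
    induction k with
    | zero => simp
    | succ k ih => rw [pow_succ, ← Matrix.vecMul_vecMul, ih, Matrix.smul_vecMul, h1, smul_smul, pow_succ]
  have h2 : Matrix.vecMul (fun i : Fin 8 => z ^ (i : ℕ)) (S8 ^ 3 + S8 ^ 4 + S8 ^ 5)
      = (z ^ 3 + z ^ 4 + z ^ 5) • (fun i : Fin 8 => z ^ (i : ℕ)) := by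
    rw [Matrix.vecMul_add, Matrix.vecMul_add, hk, hk, hk, add_smul, add_smul]
  change (fun i : Fin 8 => z ^ (i : ℕ)) ⬝ᵥ Matrix.mulVec (S8 ^ 3 + S8 ^ 4 + S8 ^ 5) f
    = (z ^ 3 + z ^ 4 + z ^ 5) * ((fun i : Fin 8 => z ^ (i : ℕ)) ⬝ᵥ f)
  rw [Matrix.dotProduct_mulVec, h2, smul_dotProduct, smul_eq_mul]

theorem pen_ev (i : Fin 8) :
    ∑ j : Fin 8, (S8 ^ 3 + S8 ^ 4 + S8 ^ 5) i j * star (omega ^ (j : ℕ))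
      = (omega ^ 3 + omega ^ 4 + omega ^ 5) * star (omega ^ (i : ℕ)) := by
  have h1 : Matrix.mulVec S8 (fun i : Fin 8 => star (omega ^ (i : ℕ)))
      = omega • (fun i : Fin 8 => star (omega ^ (i : ℕ))) := by
    ext j
    have e : ∀ k : Fin 8, (j = k + 1) ↔ (j - 1 = k) := fun k => by
      constructor
      · rintro rfl; simp
      · rintro rfl; simp
    simp only [Matrix.mulVec, dotProduct, S8, Matrix.of_apply, ite_mul, one_mul, zero_mul, e,
      Finset.sum_ite_eq, Finset.mem_univ, if_true, Pi.smul_apply, smul_eq_mul]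
    rw [fin_pow_sub omega_pow8]; simp; ring
  have hk : ∀ k : ℕ, Matrix.mulVec (S8 ^ k) (fun i : Fin 8 => star (omega ^ (i : ℕ)))
      = omega ^ k • (fun i : Fin 8 => star (omega ^ (i : ℕ))) := by
    intro k
    induction k with
    | zero => simp
    | succ k ih => rw [pow_succ, ← Matrix.mulVec_mulVec, h1, Matrix.mulVec_smul, ih, smul_smul, pow_succ, mul_comm]
  have h2 : Matrix.mulVec (S8 ^ 3 + S8 ^ 4 + S8 ^ 5) (fun i : Fin 8 => star (omega ^ (i : ℕ)))
      = (omega ^ 3 + omega ^ 4 + omega ^ 5) • (fun i : Fin 8 => star (omega ^ (i : ℕ))) := by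
    rw [Matrix.add_mulVec, Matrix.add_mulVec, hk, hk, hk, add_smul, add_smul]
  exact congrFun h2 i

theorem pen_omega : omega ^ 3 + omega ^ 4 + omega ^ 5 = ((-1 - Real.sqrt 2 : ℝ) : ℂ) := by
  have h3 : omega ^ 3 = omega * Complex.I := by rw [← omega_sq]; ring
  have h5 : omega ^ 5 = -omega := by
    rw [show (5 : ℕ) = 4 + 1 by norm_num, pow_add, omega_pow4]; ring
  rw [h3, omega_pow4, h5, omega_eq]
  push_cast
  linear_combination (Real.sqrt 2 / 2 : ℂ) * Complex.I_sq

theorem pen_re (k : Fin 8) (h1 : k ≠ 1) (h7 : k ≠ 7) :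
    -1 ≤ ((omega ^ (k : ℕ)) ^ 3 + (omega ^ (k : ℕ)) ^ 4 + (omega ^ (k : ℕ)) ^ 5).re := by
  have h3 : omega ^ 3 = omega * Complex.I := by rw [← omega_sq]; ring
  have h8 : ∀ a : ℕ, omega ^ a = omega ^ (a % 8) := fun a => by
    conv_lhs => rw [← Nat.mod_add_div a 8, pow_add, pow_mul, omega_pow8, one_pow, mul_one]
  have h5 : omega ^ 5 = -omega := by
    rw [show (5 : ℕ) = 4 + 1 by norm_num, pow_add, omega_pow4]; ring
  have h6 : omega ^ 6 = -Complex.I := by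
    rw [show (6 : ℕ) = 4 + 2 by norm_num, pow_add, omega_pow4, omega_sq]; ring
  have h7' : omega ^ 7 = -(omega * Complex.I) := by
    rw [show (7 : ℕ) = 4 + 3 by norm_num, pow_add, omega_pow4, h3]; ring
  have hr : omega.re = Real.sqrt 2 / 2 := by rw [omega_eq]; simp
  have hi : omega.im = Real.sqrt 2 / 2 := by rw [omega_eq]; simp
  have hs : 0 ≤ Real.sqrt 2 := Real.sqrt_nonneg 2
  simp only [← pow_mul]
  fin_cases k
  · simp; norm_num
  · simp at h1
  · simp only [Nat.reduceMul]
    rw [h8 (2 * 3), h8 (2 * 4), h8 (2 * 5)]; simp [h6, omega_sq]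
  · simp only
    rw [h8 (3 * 3), h8 (3 * 4), h8 (3 * 5)]; simp [omega_pow4, h7', hr, hi]; linarith
  · simp only
    rw [h8 (4 * 3), h8 (4 * 4), h8 (4 * 5)]; simp [omega_pow4]
  · simp only
    rw [h8 (5 * 3), h8 (5 * 4), h8 (5 * 5)]; simp [omega_pow4, h7', hr, hi]; linarith
  · simp only
    rw [h8 (6 * 3), h8 (6 * 4), h8 (6 * 5)]; simp [h6, omega_sq]
  · simp at h7

theorem cycle_gap (M : ℕ) (hM : 1 ≤ M) (f : ℕ → ℂ) (c : ℝ)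
    (hf : ∀ t, f (t + 2) + f t = c * f (t + 1)) (hp : ∀ t, f (t + 2 * M) = f t)
    (h0 : ∃ t, f t ≠ 0) : c = 2 ∨ c ≤ 2 - 4 / (M : ℝ) ^ 2 := by
  obtain ⟨ρ, hρ⟩ : ∃ ρ : ℂ, ρ * ρ - c * ρ + 1 = 0 := by
    obtain ⟨s, hs⟩ := IsAlgClosed.exists_pow_nat_eq ((c : ℂ) ^ 2 - 4) (n := 2) (by norm_num)
    exact ⟨(c + s) / 2, by linear_combination hs / 4⟩
  have hρ0 : ρ ≠ 0 := by rintro rfl; simp at hρ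
  have hc : (c : ℂ) = ρ + ρ⁻¹ := by field_simp; linear_combination -hρ
  have key : ∀ (g : ℕ → ℂ) (r : ℂ), (∀ t, g (t + 1) = r * g t) → (∀ t, g (t + 2 * M) = g t) →
      (∃ t, g t ≠ 0) → r ^ (2 * M) = 1 := by
    intro g r hg hgp ⟨t, ht⟩
    have : ∀ k, g (t + k) = r ^ k * g t := by
      intro k
      induction k with
      | zero => simp
      | succ k ih => rw [← add_assoc, hg, ih]; ring
    have h := this (2 * M)
    rw [hgp] at h
    exact mul_right_cancel₀ ht (by rw [← h, one_mul])
  have hr : ρ ^ (2 * M) = 1 := by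
    by_cases hg : ∃ t, f (t + 1) - ρ⁻¹ * f t ≠ 0
    · refine key (fun t => f (t + 1) - ρ⁻¹ * f t) ρ ?_ ?_ hg
      · intro t
        have := hf t
        rw [hc] at this
        have e : ρ * ρ⁻¹ = 1 := mul_inv_cancel₀ hρ0
        simp only [add_assoc, Nat.reduceAdd]
        linear_combination this + (f t) * e
      · intro t
        have e : t + 2 * M + 1 = t + 1 + 2 * M := by ring
        simp only [e, hp]
    · push Not at hg
      have := key f ρ⁻¹ (fun t => sub_eq_zero.mp (hg t)) hp h0
      rwa [inv_pow, inv_eq_one] at this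
  have hM0 : (2 * M) ≠ 0 := by omega
  have : NeZero (2 * M) := ⟨hM0⟩
  obtain ⟨j, hj, hjρ⟩ := (Complex.isPrimitiveRoot_exp (2 * M) hM0).eq_pow_of_pow_eq_one hr
  have hMr : (0 : ℝ) < M := by exact_mod_cast hM
  have hMc : (M : ℂ) ≠ 0 := by exact_mod_cast hMr.ne'
  have hρe : ρ = Complex.exp (((Real.pi * j / M : ℝ) : ℂ) * Complex.I) := by
    rw [← hjρ, ← Complex.exp_nat_mul]
    congr 1
    push_cast
    field_simp
  have hcc : c = 2 * Real.cos (Real.pi * j / M) := by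
    have : (c : ℂ) = 2 * Complex.cos ((Real.pi * j / M : ℝ) : ℂ) := by
      rw [hc, hρe, ← Complex.exp_neg, Complex.two_cos]
      congr 2; ring
    rw [← Complex.ofReal_cos] at this
    exact_mod_cast this
  have hcos : ∀ l : ℕ, 1 ≤ l → l ≤ M → Real.cos (Real.pi * l / M) ≤ 1 - 2 / (M : ℝ) ^ 2 := by
    intro l hl hlM
    have hl' : (1 : ℝ) ≤ l := by exact_mod_cast hl
    have hlM' : (l : ℝ) ≤ M := by exact_mod_cast hlM
    have hpi := Real.pi_pos
    have h := Real.cos_le_one_sub_mul_cos_sq (x := Real.pi * l / M) (by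
      rw [abs_of_nonneg (by positivity), div_le_iff₀ hMr]
      exact mul_le_mul_of_nonneg_left hlM' hpi.le)
    have e : 2 / Real.pi ^ 2 * (Real.pi * l / M) ^ 2 = 2 / (M : ℝ) ^ 2 * (l : ℝ) ^ 2 := by
      field_simp
    rw [e] at h
    have : 2 / (M : ℝ) ^ 2 * 1 ≤ 2 / (M : ℝ) ^ 2 * (l : ℝ) ^ 2 :=
      mul_le_mul_of_nonneg_left (by nlinarith) (by positivity)
    linarith
  have e4 : 2 - 4 / (M : ℝ) ^ 2 = 2 * (1 - 2 / (M : ℝ) ^ 2) := by ring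
  rcases Nat.eq_zero_or_pos j with h | h
  · left; rw [hcc, h]; simp
  · right
    rw [hcc, e4]
    refine mul_le_mul_of_nonneg_left ?_ (by norm_num)
    rcases le_or_gt j M with hjM | hjM
    · exact hcos j h hjM
    · have := hcos (2 * M - j) (by omega) (by omega)
      rw [Nat.cast_sub hj.le] at this
      have e : Real.pi * (((2 * M : ℕ) : ℝ) - j) / M = 2 * Real.pi - Real.pi * j / M := by
        push_cast; field_simp
      rwa [e, Real.cos_two_pi_sub] at this

end QC

namespace QC

theorem single_sum {n : ℕ} (q : Fin n) (x : QState n) (F : QState n → ℂ) :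
    ∑ z : QState n, (if ∀ u, u ≠ q → x u = z u then (1 : ℂ) else 0) * F z
      = ∑ a : Fin 2, F (Function.update x q a) := by
  simp only [ite_mul, one_mul, zero_mul]
  rw [← Finset.sum_filter]
  symm
  refine Finset.sum_bij' (fun a _ => Function.update x q a) (fun z _ => z q) ?_ ?_ ?_ ?_ ?_
  · intro a _
    simp only [Finset.mem_filter, Finset.mem_univ, true_and]
    intro u hu; simp [hu]
  · simp
  · simp
  · intro z hz
    simp only [Finset.mem_filter, Finset.mem_univ, true_and] at hz
    ext u
    by_cases hu : u = q
    · subst hu; simp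
    · simp [hu, hz u hu]
  · simp

theorem single_unitary {n : ℕ} (g : Matrix (Fin 2) (Fin 2) ℂ) (hg : g * gᴴ = 1) (q : Fin n) :
    applySingle n g q * (applySingle n g q)ᴴ = 1 := by
  ext x y
  simp only [Matrix.mul_apply, applySingle, Matrix.of_apply, Matrix.conjTranspose_apply]
  simp only [mul_assoc]
  rw [single_sum q x (fun z => g (x q) (z q) * star ((if ∀ u, u ≠ q → y u = z u then (1 : ℂ) else 0) * g (y q) (z q)))]
  have e : ∀ a : Fin 2, (∀ u, u ≠ q → y u = Function.update x q a u) ↔ (∀ u, u ≠ q → y u = x u) := by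
    intro a
    refine forall_congr' fun u => forall_congr' fun hu => ?_
    simp [hu]
  simp only [e, Function.update_self]
  have h := congrFun (congrFun hg (x q)) (y q)
  simp only [Matrix.mul_apply, Matrix.conjTranspose_apply] at h
  by_cases hxy : ∀ u, u ≠ q → y u = x u
  · simp only [if_pos hxy, one_mul]
    rw [h, Matrix.one_apply, Matrix.one_apply]
    congr 1
    rw [eq_iff_iff]
    constructor
    · intro h; ext u
      by_cases hu : u = q
      · subst hu; rw [h]
      · rw [hxy u hu]
    · rintro rfl; rfl
  · simp only [if_neg hxy, zero_mul, star_zero, mul_zero, Finset.sum_const_zero]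
    rw [Matrix.one_apply_ne]
    rintro rfl; exact hxy fun _ _ => rfl

theorem two_sum {n : ℕ} {q r : Fin n} (hqr : q ≠ r) (x : QState n) (F : QState n → ℂ) :
    ∑ z : QState n, (if ∀ u, u ≠ q → u ≠ r → x u = z u then (1 : ℂ) else 0) * F z
      = ∑ a : Fin 2 × Fin 2, F (Function.update (Function.update x q a.1) r a.2) := by
  simp only [ite_mul, one_mul, zero_mul]
  rw [← Finset.sum_filter]
  symm
  refine Finset.sum_bij' (fun a _ => Function.update (Function.update x q a.1) r a.2)
    (fun z _ => (z q, z r)) ?_ ?_ ?_ ?_ ?_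
  · intro a _
    simp only [Finset.mem_filter, Finset.mem_univ, true_and]
    intro u hu hu'; simp [hu, hu']
  · simp
  · simp [hqr]
  · intro z hz
    simp only [Finset.mem_filter, Finset.mem_univ, true_and] at hz
    ext u
    by_cases hu' : u = r
    · subst hu'; simp
    · by_cases hu : u = q
      · subst hu; simp [hqr]
      · simp [hu, hu', hz u hu hu']
  · simp

theorem two_unitary {n : ℕ} (g : Matrix (Fin 2 × Fin 2) (Fin 2 × Fin 2) ℂ) (hg : g * gᴴ = 1)
    {q r : Fin n} (hqr : q ≠ r) :
    applyTwo n g q r * (applyTwo n g q r)ᴴ = 1 := by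
  ext x y
  simp only [Matrix.mul_apply, applyTwo, Matrix.of_apply, Matrix.conjTranspose_apply]
  simp only [mul_assoc]
  rw [two_sum hqr x (fun z => g (x q, x r) (z q, z r) * star ((if ∀ u, u ≠ q → u ≠ r → y u = z u then (1 : ℂ) else 0) * g (y q, y r) (z q, z r)))]
  have e : ∀ a : Fin 2 × Fin 2, (∀ u, u ≠ q → u ≠ r → y u = Function.update (Function.update x q a.1) r a.2 u) ↔ (∀ u, u ≠ q → u ≠ r → y u = x u) := by
    intro a
    refine forall_congr' fun u => forall_congr' fun hu => forall_congr' fun hu' => ?_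
    simp [hu, hu']
  simp only [e, Function.update_self, Function.update_of_ne hqr, Prod.mk.eta]
  have h := congrFun (congrFun hg (x q, x r)) (y q, y r)
  simp only [Matrix.mul_apply, Matrix.conjTranspose_apply] at h
  by_cases hxy : ∀ u, u ≠ q → u ≠ r → y u = x u
  · simp only [if_pos hxy, one_mul]
    rw [h, Matrix.one_apply, Matrix.one_apply]
    congr 1
    rw [eq_iff_iff, Prod.mk.injEq]
    constructor
    · rintro ⟨h, h'⟩; ext u
      by_cases hu : u = q
      · subst hu; rw [h]
      · by_cases hu' : u = r
        · subst hu'; rw [h']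
        · rw [hxy u hu hu']
    · rintro rfl; exact ⟨rfl, rfl⟩
  · simp only [if_neg hxy, zero_mul, star_zero, mul_zero, Finset.sum_const_zero]
    rw [Matrix.one_apply_ne]
    rintro rfl; exact hxy fun _ _ _ => rfl

theorem sqrt2_ne : ((Real.sqrt 2 : ℝ) : ℂ) ≠ 0 := by
  exact_mod_cast (Real.sqrt_pos.mpr (by norm_num : (0 : ℝ) < 2)).ne'

theorem isq : ((Real.sqrt 2 : ℝ) : ℂ)⁻¹ * ((Real.sqrt 2 : ℝ) : ℂ)⁻¹ = 1 / 2 := by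
  rw [← mul_inv, ← sq, sqrt2_sq]; norm_num

theorem H_unitary : Hmat * Hmatᴴ = 1 := by
  ext i j
  fin_cases i <;> fin_cases j <;>
    simp [Hmat, Matrix.mul_apply, Fin.sum_univ_two] <;> rw [isq] <;> norm_num

theorem H_unitary' : Hmatᴴ * Hmat = 1 := mul_eq_one_comm.mp H_unitary

theorem T_unitary : Tmat * Tmatᴴ = 1 := by
  have := conj_mul_self omega_pow8
  rw [mul_comm] at this
  ext i j
  fin_cases i <;> fin_cases j <;>
    simp [Tmat, Matrix.mul_apply, Fin.sum_univ_two]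
  simpa using this

theorem HT_unitary : (Hmat * Tmat) * (Hmat * Tmat)ᴴ = 1 := by
  rw [Matrix.conjTranspose_mul, mul_assoc, ← mul_assoc Tmat, T_unitary, one_mul, H_unitary]

theorem HCNOT_apply (p q : Fin 2 × Fin 2) :
    HCNOT p q = Hmat p.1 q.1 * (if p.2 = q.2 + q.1 then 1 else 0) := by
  unfold HCNOT CNOTmat
  rw [Matrix.mul_apply, Fintype.sum_prod_type]
  simp only [Matrix.of_apply, ite_and, mul_ite, mul_one, mul_zero]
  simp

theorem HCNOT_unitary : HCNOT * HCNOTᴴ = 1 := by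
  ext ⟨a, b⟩ ⟨c, d⟩
  rw [Matrix.mul_apply, Fintype.sum_prod_type]
  simp only [Matrix.conjTranspose_apply, HCNOT_apply]
  have h := congrFun (congrFun H_unitary a) c
  rw [Matrix.mul_apply, Fin.sum_univ_two] at h
  simp only [Matrix.conjTranspose_apply, Matrix.one_apply] at h
  simp only [Fin.sum_univ_two, Matrix.one_apply, Prod.mk.injEq]
  fin_cases b <;> fin_cases d <;> simp_all

theorem good_neg1 : Good (-1) := Or.inr ⟨4, by rw [← omega_pow4]; rfl⟩
theorem good_1 : Good 1 := Or.inr ⟨0, by simp⟩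
theorem good_omega : Good omega := Or.inr ⟨1, by simp⟩
theorem good_negomega : Good (-omega) := Or.inr ⟨5, by
  change -omega = omega ^ 5
  rw [show (5 : ℕ) = 4 + 1 by norm_num, pow_add, omega_pow4]; ring⟩

theorem s2 : ((Real.sqrt 2 : ℝ) : ℂ) * ((Real.sqrt 2 : ℝ) : ℂ)⁻¹ = 1 := mul_inv_cancel₀ sqrt2_ne

theorem H_good (a b : Fin 2) : Good (-(Real.sqrt 2 : ℂ) * Hmat a b) := by
  fin_cases a <;> fin_cases b <;> simp [Hmat, s2, good_neg1, good_1]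

theorem HT_good (a b : Fin 2) : Good (-(Real.sqrt 2 : ℂ) * (Hmat * Tmat) a b) := by
  have e : (Real.sqrt 2 : ℂ) * ((Real.sqrt 2 : ℂ)⁻¹ * omega) = omega := by
    rw [← mul_assoc, s2, one_mul]
  fin_cases a <;> fin_cases b <;>
    simp [Hmat, Tmat, Matrix.mul_apply, Fin.sum_univ_two, s2, e, good_neg1, good_omega, good_negomega]

theorem good_ct {κ : Type*} (W : Matrix κ κ ℂ) (h : ∀ a b, Good (-(Real.sqrt 2 : ℂ) * W a b)) (a b : κ) :
    Good (-(Real.sqrt 2 : ℂ) * Wᴴ a b) := by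
  have := Good_star (h b a)
  simpa using this

theorem HCNOT_good (a b : Fin 2 × Fin 2) : Good (-(Real.sqrt 2 : ℂ) * HCNOT a b) := by
  rw [HCNOT_apply]
  split_ifs
  · rw [mul_one]; exact H_good _ _
  · left; simp

theorem single_good {n : ℕ} (g : Matrix (Fin 2) (Fin 2) ℂ)
    (hg : ∀ a b, Good (-(Real.sqrt 2 : ℂ) * g a b)) (q : Fin n) (x y : QState n) :
    Good (-(Real.sqrt 2 : ℂ) * applySingle n g q x y) := by
  unfold applySingle
  rw [Matrix.of_apply]
  split_ifs
  · rw [one_mul]; exact hg _ _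
  · left; simp

theorem two_good {n : ℕ} (g : Matrix (Fin 2 × Fin 2) (Fin 2 × Fin 2) ℂ)
    (hg : ∀ a b, Good (-(Real.sqrt 2 : ℂ) * g a b)) (q r : Fin n) (x y : QState n) :
    Good (-(Real.sqrt 2 : ℂ) * applyTwo n g q r x y) := by
  unfold applyTwo
  rw [Matrix.of_apply]
  split_ifs
  · rw [one_mul]; exact hg _ _
  · left; simp

theorem allowed_props {n : ℕ} {W : Matrix (QState n) (QState n) ℂ} (h : AllowedGate n W) :
    W * Wᴴ = 1 ∧ ∀ x y, Good (-(Real.sqrt 2 : ℂ) * W x y) := by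
  rcases h with ⟨q, rfl | rfl | rfl⟩ | ⟨q, r, hqr, rfl⟩
  · exact ⟨single_unitary _ H_unitary q, single_good _ H_good q⟩
  · exact ⟨single_unitary _ HT_unitary q, single_good _ HT_good q⟩
  · refine ⟨single_unitary _ ?_ q, single_good _ (good_ct _ HT_good) q⟩
    rw [Matrix.conjTranspose_conjTranspose]
    exact mul_eq_one_comm.mp HT_unitary
  · exact ⟨two_unitary _ HCNOT_unitary hqr, two_good _ HCNOT_good q r⟩

theorem W_props {n M : ℕ} {U : ℕ → Matrix (QState n) (QState n) ℂ}
    (hU : ∀ i, i < M → AllowedGate n (U i)) (s : Fin (2 * M)) :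
    Wseq n M U s * (Wseq n M U s)ᴴ = 1 ∧ ∀ x y, Good (((-(Real.sqrt 2 : ℂ)) • Wseq n M U s) x y) := by
  unfold Wseq
  simp only [Matrix.smul_apply, smul_eq_mul]
  have hs := s.2
  split_ifs with h
  · exact allowed_props (hU _ h)
  · have := allowed_props (hU (2 * M - 1 - s) (by omega))
    refine ⟨?_, good_ct _ this.2⟩
    rw [Matrix.conjTranspose_conjTranspose]
    exact mul_eq_one_comm.mp this.1

/-- Partial products. -/
noncomputable def Vp (n M : ℕ) (U : ℕ → Matrix (QState n) (QState n) ℂ) :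
    ℕ → Matrix (QState n) (QState n) ℂ
  | 0 => 1
  | t + 1 => Wseq n M U t * Vp n M U t

theorem Vp_mirror {n M : ℕ} {U : ℕ → Matrix (QState n) (QState n) ℂ}
    (hU : ∀ i, i < M → AllowedGate n (U i)) (k : ℕ) (hk : k ≤ M) :
    Vp n M U (M + k) = Vp n M U (M - k) := by
  induction k with
  | zero => simp
  | succ k ih =>
    rw [← add_assoc, Vp, ih (by omega)]
    obtain ⟨l, hl⟩ : ∃ l, M = k + 1 + l := ⟨M - (k + 1), by omega⟩
    have e1 : M - k = l + 1 := by omega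
    have e2 : M - (k + 1) = l := by omega
    rw [e1, e2, Vp, ← mul_assoc]
    have w1 : Wseq n M U (M + k) = (U l)ᴴ := by
      unfold Wseq
      rw [if_neg (by omega)]
      congr 2; omega
    have w2 : Wseq n M U l = U l := by
      unfold Wseq
      rw [if_pos (by omega)]
    rw [w1, w2, mul_eq_one_comm.mp (allowed_props (hU l (by omega))).1, one_mul]

theorem Vp_succ {n M : ℕ} {U : ℕ → Matrix (QState n) (QState n) ℂ}
    (hU : ∀ i, i < M → AllowedGate n (U i)) (s : Fin (2 * M)) :
    Vp n M U (cycSucc s : Fin (2 * M)) = Wseq n M U s * Vp n M U s := by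
  have hs := s.2
  change Vp n M U (((s : ℕ) + 1) % (2 * M)) = Vp n M U (s + 1)
  by_cases h : (s : ℕ) + 1 < 2 * M
  · rw [Nat.mod_eq_of_lt h]
  · have e : (s : ℕ) + 1 = 2 * M := by omega
    rw [e, Nat.mod_self]
    have := Vp_mirror hU M le_rfl
    rw [← two_mul, Nat.sub_self] at this
    exact this.symm

theorem Vp_unitary {n M : ℕ} {U : ℕ → Matrix (QState n) (QState n) ℂ}
    (hU : ∀ i, i < M → AllowedGate n (U i)) (t : ℕ) (ht : t ≤ 2 * M) :
    Vp n M U t * (Vp n M U t)ᴴ = 1 := by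
  induction t with
  | zero => simp [Vp]
  | succ t ih =>
    rw [Vp, Matrix.conjTranspose_mul, mul_assoc, ← mul_assoc (Vp n M U t), ih (by omega), one_mul]
    exact (W_props hU ⟨t, by omega⟩).1

theorem cycSucc_inj {m : ℕ} : Function.Injective (cycSucc (m := m)) := by
  intro a b h
  have h' : ((a : ℕ) + 1) % m = ((b : ℕ) + 1) % m := congrArg Fin.val h
  have : (a : ℕ) % m = (b : ℕ) % m := Nat.ModEq.add_right_cancel' 1 h'
  rw [Nat.mod_eq_of_lt a.2, Nat.mod_eq_of_lt b.2] at this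
  exact Fin.ext this

theorem cycSucc_surj {m : ℕ} : Function.Surjective (cycSucc (m := m)) :=
  Finite.surjective_of_injective cycSucc_inj

end QC

namespace QC

theorem hprop_entry (n M : ℕ) (U : ℕ → Matrix (QState n) (QState n) ℂ) (r t' : Fin (2 * M))
    (x y : QState n) (i j : Fin 8) :
    HpropC n M U (x, cycSucc r, i) (y, t', j)
      = (if t' = cycSucc (cycSucc r) then
          (Bmat ((-(Real.sqrt 2) : ℂ) • Wseq n M U (cycSucc r : Fin (2 * M))))ᴴ (x, i) (y, j) else 0)
        + (if t' = r then Bmat ((-(Real.sqrt 2) : ℂ) • Wseq n M U r) (x, i) (y, j) else 0) := by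
  unfold HpropC
  rw [Matrix.of_apply, Finset.sum_add_distrib]
  congr 1
  · rw [Finset.sum_eq_single (cycSucc r)]
    · simp
    · intro s _ hs
      rw [if_neg]; rintro ⟨h, _⟩; exact hs h.symm
    · simp
  · rw [Finset.sum_eq_single r]
    · simp
    · intro s _ hs
      rw [if_neg]; rintro ⟨h, _⟩; exact hs (cycSucc_inj h).symm
    · simp

theorem full_apply (n M : ℕ) (U : ℕ → Matrix (QState n) (QState n) ℂ) (v : CVertex n M → ℂ)
    (r : Fin (2 * M)) (x : QState n) (i : Fin 8) :
    (HpropC n M U + HpenC n M).mulVec v (x, cycSucc r, i)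
      = (∑ y, ∑ j, (Bmat ((-(Real.sqrt 2) : ℂ) • Wseq n M U (cycSucc r : Fin (2 * M))))ᴴ (x, i) (y, j)
            * v (y, cycSucc (cycSucc r), j))
        + (∑ y, ∑ j, Bmat ((-(Real.sqrt 2) : ℂ) • Wseq n M U r) (x, i) (y, j) * v (y, r, j))
        + ∑ j, (S8 ^ 3 + S8 ^ 4 + S8 ^ 5) i j * v (x, cycSucc r, j) := by
  rw [Matrix.add_mulVec, Pi.add_apply]
  congr 1
  · simp only [Matrix.mulVec, dotProduct, Fintype.sum_prod_type, hprop_entry, add_mul, ite_mul,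
      zero_mul, Finset.sum_add_distrib]
    congr 1
    · refine Finset.sum_congr rfl fun y _ => ?_
      rw [Finset.sum_eq_single (cycSucc (cycSucc r))]
      · simp
      · intro s _ hs; simp [hs]
      · simp
    · refine Finset.sum_congr rfl fun y _ => ?_
      rw [Finset.sum_eq_single r]
      · simp
      · intro s _ hs; simp [hs]
      · simp
  · simp only [Matrix.mulVec, dotProduct, Fintype.sum_prod_type, HpenC]
    rw [Finset.sum_eq_single x]
    · rw [Finset.sum_eq_single (cycSucc r)]
      · simp
      · intro s _ hs; simp [hs.symm]
      · simp
    · intro y _ hy; simp [hy.symm]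
    · simp

/-- Fourier component. -/
noncomputable def ft (n M : ℕ) (z : ℂ) (v : CVertex n M → ℂ) (t : Fin (2 * M)) (x : QState n) : ℂ :=
  ∑ j : Fin 8, z ^ (j : ℕ) * v (x, t, j)

theorem ft_eq {n M : ℕ} {U : ℕ → Matrix (QState n) (QState n) ℂ} {v : CVertex n M → ℂ} {μ : ℂ}
    (hv : (HpropC n M U + HpenC n M).mulVec v = μ • v) {z : ℂ} (hz : z ^ 8 = 1)
    (r : Fin (2 * M)) (x : QState n) :
    (μ - (z ^ 3 + z ^ 4 + z ^ 5)) * ft n M z v (cycSucc r) x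
      = (∑ y, star (Cz z (((-(Real.sqrt 2) : ℂ) • Wseq n M U (cycSucc r : Fin (2 * M))) y x))
          * ft n M z v (cycSucc (cycSucc r)) y)
        + ∑ y, Cz z (((-(Real.sqrt 2) : ℂ) • Wseq n M U r) x y) * ft n M z v r y := by
  have h : ∀ i : Fin 8, μ * v (x, cycSucc r, i)
      = (HpropC n M U + HpenC n M).mulVec v (x, cycSucc r, i) := fun i => by
    rw [hv, Pi.smul_apply, smul_eq_mul]
  have h2 : μ * ft n M z v (cycSucc r) x
      = ∑ i : Fin 8, z ^ (i : ℕ) * (μ * v (x, cycSucc r, i)) := by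
    unfold ft
    rw [Finset.mul_sum]
    refine Finset.sum_congr rfl fun i _ => by ring
  simp only [h, full_apply, mul_add, Finset.sum_add_distrib] at h2
  rw [trans_BH hz _ (fun y j => v (y, cycSucc (cycSucc r), j)),
    trans_B hz _ (fun y j => v (y, r, j)), pen_trans hz (fun j => v (x, cycSucc r, j))] at h2
  rw [sub_mul, h2]
  unfold ft
  ring

theorem row_sum {n : ℕ} {W : Matrix (QState n) (QState n) ℂ} (hW : W * Wᴴ = 1) 
    (hg : ∀ x y, Good (((-(Real.sqrt 2) : ℂ) • W) x y)) {z : ℂ} (hz : z ^ 8 = 1) (x : QState n) :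
    ∑ y, ‖Cz z (((-(Real.sqrt 2) : ℂ) • W) x y)‖ = 2 := by
  have h := congrFun (congrFun hW x) x
  rw [Matrix.mul_apply, Matrix.one_apply_eq] at h
  have e : ∀ y, ‖Cz z (((-(Real.sqrt 2) : ℂ) • W) x y)‖ = 2 * ‖W x y‖ ^ 2 := fun y => by
    rw [Cz_norm hz (hg x y), Matrix.smul_apply, smul_eq_mul, norm_mul, mul_pow, norm_neg,
      Complex.norm_real, Real.norm_eq_abs, sq_abs, Real.sq_sqrt (by norm_num)]
  simp only [e]
  rw [← Finset.mul_sum]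
  have h' : ((∑ y, ‖W x y‖ ^ 2 : ℝ) : ℂ) = 1 := by
    rw [← h]
    push_cast
    refine Finset.sum_congr rfl fun y _ => ?_
    rw [Matrix.conjTranspose_apply]
    exact (Complex.mul_conj' _).symm
  have h'' : (∑ y, ‖W x y‖ ^ 2 : ℝ) = 1 := by exact_mod_cast h'
  rw [h'']; norm_num

theorem col_sum {n : ℕ} {W : Matrix (QState n) (QState n) ℂ} (hW : W * Wᴴ = 1) 
    (hg : ∀ x y, Good (((-(Real.sqrt 2) : ℂ) • W) x y)) {z : ℂ} (hz : z ^ 8 = 1) (x : QState n) :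
    ∑ y, ‖Cz z (((-(Real.sqrt 2) : ℂ) • W) y x)‖ = 2 := by
  have hg' : ∀ x y, Good (((-(Real.sqrt 2) : ℂ) • Wᴴ) x y) := fun x y => by
    have := Good_star (hg y x)
    simpa using this
  have h := row_sum (W := Wᴴ) (by rw [Matrix.conjTranspose_conjTranspose]; exact mul_eq_one_comm.mp hW) hg' hz x
  refine Eq.trans (Finset.sum_congr rfl fun y _ => ?_) h
  rw [Cz_norm hz (hg y x), Cz_norm hz (hg' x y)]
  simp

theorem crude {n M : ℕ} {U : ℕ → Matrix (QState n) (QState n) ℂ}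
    (hU : ∀ i, i < M → AllowedGate n (U i)) {v : CVertex n M → ℂ} {μ : ℂ}
    (hv : (HpropC n M U + HpenC n M).mulVec v = μ • v) {z : ℂ} (hz : z ^ 8 = 1)
    (hne : ∃ t x, ft n M z v t x ≠ 0) : ‖μ - (z ^ 3 + z ^ 4 + z ^ 5)‖ ≤ 4 := by
  obtain ⟨t0, x0, h0⟩ := hne
  have : Nonempty (Fin (2 * M) × QState n) := ⟨(t0, x0)⟩
  obtain ⟨⟨t, x⟩, hmax⟩ := Finite.exists_max (fun p : Fin (2 * M) × QState n => ‖ft n M z v p.1 p.2‖)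
  obtain ⟨r, rfl⟩ := cycSucc_surj t
  set m := ‖ft n M z v (cycSucc r) x‖ with hm
  have hmpos : 0 < m := lt_of_lt_of_le (norm_pos_iff.mpr h0) (hmax (t0, x0))
  have h := congrArg norm (ft_eq hv hz r x)
  rw [norm_mul] at h
  have b1 : ‖∑ y, star (Cz z (((-(Real.sqrt 2) : ℂ) • Wseq n M U (cycSucc r : Fin (2 * M))) y x))
          * ft n M z v (cycSucc (cycSucc r)) y‖ ≤ 2 * m := by
    obtain ⟨p1, p2⟩ := W_props hU (cycSucc r)
    have hsum := congrArg (fun a => a * m) (col_sum p1 p2 hz x)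
    simp only [Finset.sum_mul] at hsum
    refine le_trans (norm_sum_le_of_le _ fun y _ => ?_) hsum.le
    rw [norm_mul, norm_star]
    exact mul_le_mul_of_nonneg_left (hmax (_, y)) (norm_nonneg _)
  have b2 : ‖∑ y, Cz z (((-(Real.sqrt 2) : ℂ) • Wseq n M U r) x y) * ft n M z v r y‖ ≤ 2 * m := by
    obtain ⟨p1, p2⟩ := W_props hU r
    have hsum := congrArg (fun a => a * m) (row_sum p1 p2 hz x)
    simp only [Finset.sum_mul] at hsum
    refine le_trans (norm_sum_le_of_le _ fun y _ => ?_) hsum.le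
    rw [norm_mul]
    exact mul_le_mul_of_nonneg_left (hmax (_, y)) (norm_nonneg _)
  have b3 := norm_add_le (∑ y, star (Cz z (((-(Real.sqrt 2) : ℂ) • Wseq n M U (cycSucc r : Fin (2 * M))) y x))
          * ft n M z v (cycSucc (cycSucc r)) y) (∑ y, Cz z (((-(Real.sqrt 2) : ℂ) • Wseq n M U r) x y) * ft n M z v r y)
  rw [← h] at b3
  have : ‖μ - (z ^ 3 + z ^ 4 + z ^ 5)‖ * m ≤ 4 * m := by linarith
  exact le_of_mul_le_mul_right this hmpos

/-- The gap in the `ω` sector. -/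
theorem sector {n M : ℕ} (hM : 1 ≤ M) {U : ℕ → Matrix (QState n) (QState n) ℂ}
    (hU : ∀ i, i < M → AllowedGate n (U i)) (u : Fin (2 * M) → QState n → ℂ) (c : ℝ)
    (hu : ∀ r : Fin (2 * M), (c : ℂ) • u (cycSucc r)
      = (Wseq n M U (cycSucc r : Fin (2 * M)))ᴴ.mulVec (u (cycSucc (cycSucc r)))
        + (Wseq n M U r).mulVec (u r))
    (hne : ∃ t x, u t x ≠ 0) : c = 2 ∨ c ≤ 2 - 4 / (M : ℝ) ^ 2 := by
  set w : Fin (2 * M) → QState n → ℂ := fun t => (Vp n M U t)ᴴ.mulVec (u t) with hw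
  have hwrec : ∀ r, w (cycSucc (cycSucc r)) + w r = (c : ℂ) • w (cycSucc r) := by
    intro r
    simp only [hw]
    rw [← Matrix.mulVec_smul, hu, Matrix.mulVec_add, Matrix.mulVec_mulVec, Matrix.mulVec_mulVec,
      ← Matrix.conjTranspose_mul, ← Vp_succ hU (cycSucc r), Vp_succ hU r, Matrix.conjTranspose_mul,
      mul_assoc, mul_eq_one_comm.mp (W_props hU r).1, mul_one]
  obtain ⟨t, x, htx⟩ := hne
  have hwne : w t ≠ 0 := by
    intro h0
    apply htx
    have : u t = (Vp n M U t).mulVec (w t) := by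
      simp only [hw]
      rw [Matrix.mulVec_mulVec, Vp_unitary hU t t.2.le, Matrix.one_mulVec]
    rw [this, h0, Matrix.mulVec_zero]; rfl
  obtain ⟨y, hy⟩ := Function.ne_iff.mp hwne
  have hN : 0 < 2 * M := by omega
  have hs : ∀ k : ℕ, cycSucc (⟨k % (2 * M), Nat.mod_lt _ hN⟩ : Fin (2 * M))
      = ⟨(k + 1) % (2 * M), Nat.mod_lt _ hN⟩ := fun k => by
    unfold cycSucc
    simp
  refine cycle_gap M hM (fun k => w ⟨k % (2 * M), Nat.mod_lt _ hN⟩ y) c ?_ ?_ ?_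
  · intro k
    have := congrFun (hwrec ⟨k % (2 * M), Nat.mod_lt _ hN⟩) y
    rw [hs, hs] at this
    exact this
  · intro k
    simp
  · refine ⟨t, ?_⟩
    simp only [Nat.mod_eq_of_lt t.2]
    exact hy

theorem sector_mu {n M : ℕ} (hM : 1 ≤ M) {U : ℕ → Matrix (QState n) (QState n) ℂ}
    (hU : ∀ i, i < M → AllowedGate n (U i)) {v : CVertex n M → ℂ} {μ : ℝ}
    (hv : (HpropC n M U + HpenC n M).mulVec v = (μ : ℂ) • v)
    (hne : ∃ t x, ft n M omega v t x ≠ 0) : μ = e1 ∨ e1 + 1 / (5 * (M : ℝ) ^ 2) ≤ μ := by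
  have hs2 : (0 : ℝ) < Real.sqrt 2 := Real.sqrt_pos.mpr (by norm_num)
  have hsq : Real.sqrt 2 * Real.sqrt 2 = 2 := Real.mul_self_sqrt (by norm_num)
  have h1s : (1 : ℝ) ≤ Real.sqrt 2 := by nlinarith
  set c : ℝ := -(μ + 1 + Real.sqrt 2) / Real.sqrt 2 with hc
  have hcμ : μ = -1 - Real.sqrt 2 - Real.sqrt 2 * c := by rw [hc]; field_simp; ring
  have := sector hM hU (ft n M omega v) c (by
    intro r
    ext x
    have h := ft_eq hv omega_pow8 r x
    simp only [Cz_omega ((W_props hU r).2 _ _), Cz_omega ((W_props hU (cycSucc r)).2 _ _)] at h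
    rw [pen_omega, hcμ] at h
    simp only [Pi.smul_apply, Pi.add_apply, Matrix.mulVec, dotProduct, smul_eq_mul,
      Matrix.conjTranspose_apply]
    simp only [Matrix.smul_apply, smul_eq_mul, star_mul', mul_assoc, ← Finset.mul_sum] at h
    have e : star (-(Real.sqrt 2 : ℂ)) = -(Real.sqrt 2 : ℂ) := by
      rw [star_neg]; congr 1; exact Complex.conj_ofReal _
    rw [e] at h
    push_cast at h
    apply mul_left_cancel₀ (neg_ne_zero.mpr sqrt2_ne)
    linear_combination h) hne
  have hMr : (1 : ℝ) ≤ M := by exact_mod_cast hM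
  unfold e1
  rcases this with h | h
  · left; rw [hcμ, h]; ring
  · right
    have e : 1 / (5 * (M : ℝ) ^ 2) = 1 / 5 * (1 / (M : ℝ) ^ 2) := by field_simp
    have e' : 4 / (M : ℝ) ^ 2 = 4 * (1 / (M : ℝ) ^ 2) := by field_simp
    have hp : 0 < 1 / (M : ℝ) ^ 2 := by positivity
    rw [e, hcμ]
    rw [e'] at h
    nlinarith [mul_le_mul_of_nonneg_left h hs2.le]

theorem gap {n M : ℕ} (hM : 1 ≤ M) {U : ℕ → Matrix (QState n) (QState n) ℂ}
    (hU : ∀ i, i < M → AllowedGate n (U i)) (μ : ℝ)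
    (h : Module.End.HasEigenvalue (HpropC n M U + HpenC n M).mulVecLin (μ : ℂ)) :
    μ = e1 ∨ e1 + 1 / (5 * (M : ℝ) ^ 2) ≤ μ := by
  obtain ⟨v, hv⟩ := h.exists_hasEigenvector
  have hv0 := hv.2
  have hv1 : (HpropC n M U + HpenC n M).mulVec v = (μ : ℂ) • v := hv.apply_eq_smul
  obtain ⟨⟨x, t, j⟩, hj⟩ := Function.ne_iff.mp hv0
  obtain ⟨k, hk⟩ : ∃ k : Fin 8, ft n M (omega ^ (k : ℕ)) v t x ≠ 0 := by
    by_contra hcon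
    push Not at hcon
    have := Matrix.eq_zero_of_forall_index_sum_pow_mul_eq_zero
      (f := fun k : Fin 8 => omega ^ (k : ℕ)) (v := fun j => v (x, t, j))
      (fun a b hab => omega_inj hab) hcon
    exact hj (congrFun this j)
  have hz : (omega ^ (k : ℕ)) ^ 8 = 1 := by rw [← pow_mul, mul_comm, pow_mul, omega_pow8, one_pow]
  by_cases h1 : k = 1
  · subst h1
    refine sector_mu hM hU hv1 ⟨t, x, ?_⟩
    simpa using hk
  by_cases h7 : k = 7
  · subst h7
    have hA : ∀ p q, star ((HpropC n M U + HpenC n M) p q) = (HpropC n M U + HpenC n M) p q := by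
      have hS : ∀ k : ℕ, ∀ a b, star ((S8 ^ k) a b) = (S8 ^ k) a b := by
        intro k
        induction k with
        | zero => intro a b; simp [Matrix.one_apply]
        | succ k ih =>
          intro a b
          rw [pow_succ, Matrix.mul_apply, star_sum]
          refine Finset.sum_congr rfl fun c _ => ?_
          rw [star_mul', ih]; congr 1
          simp only [S8, Matrix.of_apply]; split_ifs <;> simp
      intro p q
      rw [Matrix.add_apply, star_add]
      congr 1
      · simp only [HpropC, Matrix.of_apply, star_sum]
        refine Finset.sum_congr rfl fun s _ => ?_
        simp only [Matrix.conjTranspose_apply, Bmat, Matrix.of_apply]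
        rw [star_add]
        congr 1
        · split_ifs <;> simp
        · split_ifs <;> simp
      · simp only [HpenC, Matrix.of_apply, Matrix.add_apply]
        split_ifs
        · rw [star_add, star_add, hS, hS, hS]
        · simp
    have hv2 : (HpropC n M U + HpenC n M).mulVec (star v) = (μ : ℂ) • star v := by
      ext p
      have := congrArg star (congrFun hv1 p)
      simp only [Matrix.mulVec, dotProduct, star_sum, star_mul', hA, Pi.smul_apply, smul_eq_mul] at this ⊢
      have e : star (μ : ℂ) = μ := Complex.conj_ofReal _
      rw [e] at this
      exact this
    refine sector_mu hM hU hv2 ⟨t, x, ?_⟩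
    have e : omega = star (omega ^ 7) := by
      have h1 := conj_mul_self (z := omega ^ 7) (by rw [← pow_mul, mul_comm, pow_mul, omega_pow8, one_pow])
      have h2 : omega * omega ^ 7 = 1 := by rw [← omega_pow8]; ring
      exact mul_right_cancel₀ (pow_ne_zero 7 omega_ne) (h2.trans h1.symm)
    have e2 : ft n M omega (star v) t x = star (ft n M (omega ^ 7) v t x) := by
      unfold ft
      rw [star_sum]
      refine Finset.sum_congr rfl fun j _ => ?_
      rw [star_mul', star_pow, ← e]; rfl
    rw [e2]
    exact star_ne_zero.mpr hk
  · right
    have hb := crude hU hv1 hz ⟨t, x, hk⟩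
    have hr := pen_re k h1 h7
    have h3 := (Complex.abs_re_le_norm _).trans hb
    rw [Complex.sub_re, Complex.ofReal_re] at h3
    have h4 := (abs_le.mp h3).1
    have hMr : (1 : ℝ) ≤ M := by exact_mod_cast hM
    have h5 : 1 / (5 * (M : ℝ) ^ 2) ≤ 1 / 5 := by
      apply one_div_le_one_div_of_le (by norm_num)
      nlinarith
    have h6 : (1.41 : ℝ) ≤ Real.sqrt 2 := Real.le_sqrt_of_sq_le (by norm_num)
    unfold e1
    linarith

theorem exists_ev {n M : ℕ} (hM : 1 ≤ M) {U : ℕ → Matrix (QState n) (QState n) ℂ}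
    (hU : ∀ i, i < M → AllowedGate n (U i)) :
    Module.End.HasEigenvalue (HpropC n M U + HpenC n M).mulVecLin ((e1 : ℝ) : ℂ) := by
  set u : Fin (2 * M) → QState n → ℂ := fun t => (Vp n M U t).mulVec (fun _ => 1) with hu
  have hus : ∀ r : Fin (2 * M), (Wseq n M U r).mulVec (u r) = u (cycSucc r) := fun r => by
    simp only [hu]
    rw [Matrix.mulVec_mulVec, Vp_succ hU]
  have hus' : ∀ r : Fin (2 * M), (Wseq n M U r)ᴴ.mulVec (u (cycSucc r)) = u r := fun r => by
    rw [← hus, Matrix.mulVec_mulVec, mul_eq_one_comm.mp (W_props hU r).1, Matrix.one_mulVec]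
  refine Module.End.hasEigenvalue_of_hasEigenvector
    (x := fun p : CVertex n M => star (omega ^ (p.2.2 : ℕ)) * u p.2.1 p.1) ?_
  rw [Module.End.hasEigenvector_iff, Module.End.mem_eigenspace_iff]
  constructor
  · rw [Matrix.mulVecLin_apply]
    ext ⟨x, t, i⟩
    obtain ⟨r, rfl⟩ := cycSucc_surj t
    rw [full_apply]
    simp only
    rw [ev_BH _ (W_props hU _).2, ev_B _ (W_props hU _).2]
    have h1 : ∑ j : Fin 8, (S8 ^ 3 + S8 ^ 4 + S8 ^ 5) i j * (star (omega ^ (j : ℕ)) * u (cycSucc r) x)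
        = ((-1 - Real.sqrt 2 : ℝ) : ℂ) * star (omega ^ (i : ℕ)) * u (cycSucc r) x := by
      rw [← pen_omega, ← pen_ev, Finset.sum_mul]
      refine Finset.sum_congr rfl fun j _ => by ring
    rw [h1]
    have h2 := congrFun (hus r) x
    have h3 := congrFun (hus' (cycSucc r)) x
    simp only [Matrix.mulVec, dotProduct, Matrix.conjTranspose_apply] at h2 h3
    have e : star (-(Real.sqrt 2 : ℂ)) = -(Real.sqrt 2 : ℂ) := by
      rw [star_neg]; congr 1; exact Complex.conj_ofReal _
    simp only [Matrix.smul_apply, smul_eq_mul, star_mul', e, mul_assoc, ← Finset.mul_sum, Pi.smul_apply]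
    rw [h2, h3]
    unfold e1
    push_cast
    ring
  · intro h0
    have := congrFun h0 (fun _ => 0, ⟨0, by omega⟩, 0)
    simp [hu, Vp] at this

end QC

/-- The smallest eigenvalue of `H_prop + H_penalty` equals
`e₁ = −1 − 3√2`, and every eigenvalue of `H_prop + H_penalty` other than `e₁` is at
least `e₁ + 1/(5M²)`. -/
theorem hprop_hpenalty_spectral_gap
    (n M : ℕ) (hn : 1 ≤ n) (hM : 1 ≤ M)
    (U : ℕ → Matrix (QState n) (QState n) ℂ)
    (hU : ∀ i, i < M → AllowedGate n (U i)) :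
    Module.End.HasEigenvalue (HpropC n M U + HpenC n M).mulVecLin ((e1 : ℝ) : ℂ)
    ∧ (∀ μ : ℝ, Module.End.HasEigenvalue (HpropC n M U + HpenC n M).mulVecLin ((μ : ℝ) : ℂ)
        → e1 ≤ μ)
    ∧ (∀ μ : ℝ, Module.End.HasEigenvalue (HpropC n M U + HpenC n M).mulVecLin ((μ : ℝ) : ℂ)
        → μ ≠ e1 → e1 + 1 / (5 * (M : ℝ) ^ 2) ≤ μ) := by
  refine ⟨exists_ev hM hU, fun μ h => ?_, fun μ h hne => (gap hM hU μ h).resolve_left hne⟩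
  rcases gap hM hU μ h with h | h
  · exact h.ge
  · refine le_trans ?_ h
    have : 0 ≤ 1 / (5 * (M : ℝ) ^ 2) := by positivity
    linarith
end
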